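/- arXiv:2211.13361 — 3 statements merged into one kernel-verified Lean document; each statement's English description precedes it below -/
import Mathlib

section
/- Let A be a progressive set of infinite regular cardinals, i.e., |A| < min(A). Then spec(A) ⊆ pcf(A) ∪ lim(pcf(A)): every regular cardinal in spec(A) either belongs to pcf(A) or is a limit point of pcf(A). -/
universe u

open Cardinal Set

namespace TukeySpec

/-- A subset `S` of a preorder is cofinal if every element has an upper bound in `S`. -/
def IsCofinal {P : Type*} [Preorder P] (S : Set P) : Prop :=
  ∀ p : P, ∃ s ∈ S, p ≤ s

/-- `Q` is a Tukey quotient of `P` (i.e. `P ≥_T Q`): there is a map `P → Q`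
sending cofinal sets to cofinal sets. -/
def TukeyQuot (P : Type*) (Q : Type*) [Preorder P] [Preorder Q] : Prop :=
  ∃ φ : P → Q, ∀ S : Set P, IsCofinal S → IsCofinal (φ '' S)

/-- `P` has calibre `(κ, l, m)`. -/
def Calibre (P : Type u) [Preorder P] (κ l m : Cardinal.{u}) : Prop :=
  ∀ P' : Set P, #P' = κ → ∃ R ⊆ P', #R = l ∧ ∀ B ⊆ R, #B = m → BddAbove B

/-- `P` has calibre `κ` (the simplified form): every `κ`-sized subset has a
`κ`-sized subset which is bounded in `P`. -/
def CalibreSimple (P : Type u) [Preorder P] (κ : Cardinal.{u}) : Prop :=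
  ∀ P' : Set P, #P' = κ → ∃ R ⊆ P', #R = κ ∧ BddAbove R

/-- The Tukey spectrum of a poset: all regular cardinals `κ` with `P ≥_T κ`,
where `κ` carries its usual (ordinal) ordering. -/
def specPoset (P : Type u) [Preorder P] : Set Cardinal.{u} :=
  {κ | κ.IsRegular ∧ TukeyQuot P ↥(Set.Iio κ.ord)}

/-- The product `∏A` of a set of cardinals: all functions on `A` with
`f a < a` (as ordinals). -/
def piSet (A : Set Cardinal.{0}) : Set (↥A → Ordinal.{0}) :=
  {f | ∀ a : ↥A, f a < (a : Cardinal).ord}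

/-- A family of members of `∏A` is bounded if it has an upper bound in `(∏A, ≤)`
(pointwise order). -/
def BddIn (A : Set Cardinal.{0}) (S : Set (↥A → Ordinal.{0})) : Prop :=
  ∃ h ∈ piSet A, ∀ f ∈ S, ∀ a : ↥A, f a ≤ h a

/-- The Tukey spectrum of a set `A` of regular cardinals: all regular `κ` for which
there is a `κ`-sized family `F ⊆ ∏A` all of whose `κ`-sized subfamilies are
unbounded in `(∏A, ≤)`. -/
def spec (A : Set Cardinal.{0}) : Set Cardinal.{0} :=
  {κ | κ.IsRegular ∧ ∃ F ⊆ piSet A, #F = Cardinal.lift.{1} κ ∧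
    ∀ F₀ ⊆ F, #F₀ = Cardinal.lift.{1} κ → ¬ BddIn A F₀}

/-- `cf(∏A/D)`: the least cardinality of a subset of `∏A` which is cofinal
modulo the ultrafilter `D`. -/
noncomputable def cofUlt (A : Set Cardinal.{0}) (D : Ultrafilter ↥A) : Cardinal.{1} :=
  sInf {c : Cardinal.{1} | ∃ S ⊆ piSet A, #S = c ∧
    ∀ f ∈ piSet A, ∃ g ∈ S, {a : ↥A | f a ≤ g a} ∈ D}

/-- `pcf(A)`: the set of all cofinalities `cf(∏A/D)` as `D` ranges over
ultrafilters on `A`. -/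
def pcf (A : Set Cardinal.{0}) : Set Cardinal.{0} :=
  {κ | ∃ D : Ultrafilter ↥A, Cardinal.lift.{1} κ = cofUlt A D}

/-- `ub(F)`: the set of coordinates `a ∈ A` where the family `F` is unbounded. -/
def ub (A : Set Cardinal.{0}) (F : Set (↥A → Ordinal.{0})) : Set ↥A :=
  {a | ∀ β < (a : Cardinal).ord, ∃ f ∈ F, β < f a}

/-- The strong part of the Tukey spectrum: `l ∈ spec*(A)` iff there is an
`l`-sized family `F ⊆ ∏A` such that every `l`-sized subfamily has a set of
unbounded coordinates which is unbounded in `sup A`. -/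
def specStarMem (A : Set Cardinal.{0}) (l : Cardinal.{0}) : Prop :=
  l.IsRegular ∧ ∃ F ⊆ piSet A, #F = Cardinal.lift.{1} l ∧
    ∀ F₀ ⊆ F, #F₀ = Cardinal.lift.{1} l →
      ∀ β < sSup A, ∃ a ∈ ub A F₀, β < (a : Cardinal)

/-- `κ` is a limit point of the set `X` of cardinals. -/
def IsLimitPt (X : Set Cardinal.{0}) (κ : Cardinal.{0}) : Prop :=
  ∀ β < κ, ∃ x ∈ X, β < x ∧ x < κ

/-- `C` is a closed unbounded subset of `κ`. -/
def IsClubIn (C : Set Ordinal.{0}) (κ : Ordinal.{0}) : Prop :=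
  C ⊆ Set.Iio κ ∧ (∀ β < κ, ∃ o ∈ C, β < o) ∧
    ∀ β < κ, β ≠ 0 → (∀ γ < β, ∃ o ∈ C, γ < o ∧ o < β) → β ∈ C

/-- A set `S` of cardinals is stationary in `κ`: it meets every club of `κ`. -/
def StatIn (S : Set Cardinal.{0}) (κ : Cardinal.{0}) : Prop :=
  ∀ C : Set Ordinal.{0}, IsClubIn C κ.ord → ∃ a ∈ S, a.ord ∈ C

/-- `κ` is Mahlo: strongly inaccessible and the regular cardinals below `κ`
are stationary in `κ`. -/
def IsMahlo (κ : Cardinal.{0}) : Prop :=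
  κ.IsInaccessible ∧ StatIn {a | a < κ ∧ a.IsRegular} κ

/-- `κ` is weakly compact: strongly inaccessible and `κ → (κ)²₂`. -/
def IsWeaklyCompact (κ : Cardinal.{0}) : Prop :=
  κ.IsInaccessible ∧
    ∀ c : Ordinal.{0} → Ordinal.{0} → Bool,
      ∃ H ⊆ Set.Iio κ.ord, #H = Cardinal.lift.{1} κ ∧
        ∃ b : Bool, ∀ α ∈ H, ∀ β ∈ H, α < β → c α β = b

/-- `θ` carries a Jónsson algebra: there is `F` from finite subsets of `θ` to `θ`
such that `F` applied to finite subsets of any `θ`-sized `H ⊆ θ` covers `θ`. -/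
def CarriesJonsson (θ : Cardinal.{0}) : Prop :=
  ∃ F : Finset Ordinal.{0} → Ordinal.{0},
    (∀ s : Finset Ordinal.{0}, (↑s : Set Ordinal) ⊆ Set.Iio θ.ord → F s < θ.ord) ∧
    ∀ H ⊆ Set.Iio θ.ord, #H = Cardinal.lift.{1} θ →
      ∀ γ < θ.ord, ∃ s : Finset Ordinal.{0}, (↑s : Set Ordinal) ⊆ H ∧ F s = γ

/-- `cf(∏A/J_bd)`: the least cardinality of a subset of `∏A` cofinal modulo
the ideal of bounded subsets of `A`. -/
noncomputable def cofJbd (A : Set Cardinal.{0}) : Cardinal.{1} :=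
  sInf {c : Cardinal.{1} | ∃ S ⊆ piSet A, #S = c ∧
    ∀ f ∈ piSet A, ∃ g ∈ S, ∃ b < sSup A, ∀ a : ↥A, b < (a : Cardinal) → f a ≤ g a}

/-- `μ` is a limit cardinal. -/
def IsLimitCard (μ : Cardinal.{0}) : Prop :=
  ℵ₀ ≤ μ ∧ ∀ ν < μ, Order.succ ν < μ


/-- Existence of a function defined by well-founded recursion with a choice at each step. -/
theorem rec_exists {I : Type*} {Y : Type*} [LinearOrder I] [WellFoundedLT I]
    (Q : (α : I) → ((β : I) → β < α → Y) → Y → Prop)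
    (h : ∀ α prev, ∃ y, Q α prev y) :
    ∃ g : I → Y, ∀ α, Q α (fun β _ => g β) (g α) := by
  choose step hstep using h
  let g : I → Y := (wellFounded_lt (α := I)).fix (fun α prev => step α prev)
  refine ⟨g, fun α => ?_⟩
  have : g α = step α (fun β _ => g β) := WellFounded.fix_eq _ _ _
  rw [this]
  exact hstep _ _

theorem chain_exists {Y : Type u} [Preorder Y] (θ : Cardinal.{u})
    (hY : ∀ S : Set Y, #S < θ → ∃ y, ∀ s ∈ S, s ≤ y) (next : Y → Y) :
    ∃ g : θ.ord.ToType → Y, ∀ α β, β < α → next (g β) ≤ g α := by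
  obtain ⟨g, hg⟩ := rec_exists (I := θ.ord.ToType) (Y := Y)
    (fun α prev y => ∀ β (hβ : β < α), next (prev β hβ) ≤ y) (by
      intro α prev
      obtain ⟨y, hy⟩ := hY (Set.range fun b : Set.Iio α => next (prev b.1 b.2))
        (mk_range_le.trans_lt (mk_Iio_toType_ord_lt α))
      exact ⟨y, fun β hβ => hy _ ⟨⟨β, hβ⟩, rfl⟩⟩)
  exact ⟨g, fun α β hβ => hg α β hβ⟩

/-- A `θ`-chain cannot pick pairwise different elements of a set smaller than `θ`. -/
theorem no_inj {ι : Type u} {θ : Cardinal.{u}} (hν : #ι < θ) (pick : θ.ord.ToType → ι)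
    (h : ∀ α β, β < α → pick β ≠ pick α) : False := by
  have hinj : Function.Injective pick := by
    intro a b hab
    rcases lt_trichotomy a b with h1 | h1 | h1
    · exact absurd hab (h _ _ h1)
    · exact h1
    · exact absurd hab.symm (h _ _ h1)
  have := mk_le_of_injective hinj
  rw [mk_ord_toType] at this
  exact absurd hν (not_lt.2 this)

section Abstract

variable {ι : Type u} {X : ι → Type u} [∀ i, LinearOrder (X i)] {c : ι → Cardinal.{u}}
  {θ : Cardinal.{u}}

theorem small_bdd (hc : ∀ i (S : Set (X i)), #S < c i → ∃ x, ∀ s ∈ S, s < x)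
    (hθc : ∀ i, θ ≤ c i) (S : Set (∀ i, X i)) (hS : #S < θ) :
    ∃ g : ∀ i, X i, ∀ f ∈ S, f ≤ g := by
  have : ∀ i, ∃ x : X i, ∀ f ∈ S, f i < x := by
    intro i
    obtain ⟨x, hx⟩ := hc i ((fun f => f i) '' S) (mk_image_le.trans_lt (hS.trans_le (hθc i)))
    exact ⟨x, fun f hf => hx _ ⟨f, hf, rfl⟩⟩
  choose g hg using this
  exact ⟨g, fun f hf i => (hg i f hf).le⟩

theorem small_bdd' (hc : ∀ i (S : Set (X i)), #S < c i → ∃ x, ∀ s ∈ S, s < x)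
    (hpos : ∀ i, 0 < c i) (S : Set (∀ i, X i)) (hS : #S ≤ θ) :
    ∃ g : ∀ i, X i, ∀ f ∈ S, ∀ i, θ < c i → f i < g i := by
  have : ∀ i, ∃ x : X i, ∀ f ∈ S, θ < c i → f i < x := by
    intro i
    by_cases hi : θ < c i
    · obtain ⟨x, hx⟩ := hc i ((fun f => f i) '' S) (mk_image_le.trans_lt (hS.trans_lt hi))
      exact ⟨x, fun f hf _ => hx _ ⟨f, hf, rfl⟩⟩
    · obtain ⟨x, hx⟩ := hc i ∅ (by simpa using hpos i)
      exact ⟨x, fun f hf h => absurd h hi⟩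
  choose g hg using this
  exact ⟨g, fun f hf i => hg i f hf⟩

theorem inc_exists (DD : Set (Ultrafilter ι)) (μ : Cardinal.{u})
    (hdir : ∀ S : Set (∀ i, X i), #S < μ →
      ∃ g : ∀ i, X i, ∀ D ∈ DD, ∀ f ∈ S, ∀ᶠ i in (D : Filter ι), f i ≤ g i)
    (p : μ.ord.ToType → ∀ i, X i) :
    ∃ q : μ.ord.ToType → ∀ i, X i, (∀ k, p k ≤ q k) ∧
      ∀ k l, l ≤ k → ∀ D ∈ DD, ∀ᶠ i in (D : Filter ι), q l i ≤ q k i := by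
  obtain ⟨q, hq⟩ := rec_exists (I := μ.ord.ToType) (Y := ∀ i, X i)
    (fun α prev y => p α ≤ y ∧ ∀ β (hβ : β < α), ∀ D ∈ DD,
      ∀ᶠ i in (D : Filter ι), prev β hβ i ≤ y i) (by
      intro α prev
      obtain ⟨y, hy⟩ := hdir (Set.range fun b : Set.Iio α => prev b.1 b.2)
        (mk_range_le.trans_lt (mk_Iio_toType_ord_lt α))
      refine ⟨p α ⊔ y, le_sup_left, fun β hβ D hD => ?_⟩
      filter_upwards [hy D hD _ ⟨⟨β, hβ⟩, rfl⟩] with i hi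
      exact hi.trans le_sup_right)
  refine ⟨q, fun k => (hq k).1, fun k l hl D hD => ?_⟩
  rcases hl.lt_or_eq with h | rfl
  · exact (hq k).2 l h D hD
  · exact Filter.Eventually.of_forall fun i => le_rfl

/-- `λ`-directedness modulo all ultrafilters in a class of `λ`-directed ones. -/
theorem dir_exists (hc : ∀ i (S : Set (X i)), #S < c i → ∃ x, ∀ s ∈ S, s < x)
    (hpos : ∀ i, 0 < c i) (hθc : ∀ i, θ ≤ c i) (hν : #ι < θ)
    (DD : Set (Ultrafilter ι)) (l : Cardinal.{u})
    (h1 : ∀ D ∈ DD, ∀ᶠ i in (D : Filter ι), θ < c i)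
    (h2 : ∀ D ∈ DD, ∀ S : Set (∀ i, X i), #S < l →
      ∃ g : ∀ i, X i, ∀ f ∈ S, ∀ᶠ i in (D : Filter ι), f i ≤ g i) :
    ∀ S : Set (∀ i, X i), #S < l →
      ∃ g : ∀ i, X i, ∀ D ∈ DD, ∀ f ∈ S, ∀ᶠ i in (D : Filter ι), f i ≤ g i := by
  suffices H : ∀ μ : Cardinal.{u}, μ < l → ∀ S : Set (∀ i, X i), #S = μ →
      ∃ g : ∀ i, X i, ∀ D ∈ DD, ∀ f ∈ S, ∀ᶠ i in (D : Filter ι), f i ≤ g i from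
    fun S hS => H _ hS S rfl
  intro μ
  induction μ using WellFoundedLT.induction with
  | ind μ ih =>
  intro hμl S hS
  rcases le_or_gt μ θ with hμ | hμ
  · obtain ⟨g, hg⟩ := small_bdd' (θ := θ) hc hpos S (hS.trans_le hμ)
    refine ⟨g, fun D hD f hf => ?_⟩
    filter_upwards [h1 D hD] with i hi
    exact (hg f hf i hi).le
  obtain ⟨e⟩ : Nonempty (μ.ord.ToType ≃ S) := by
    apply Cardinal.eq.1; rw [mk_ord_toType, hS]
  obtain ⟨q, hpq, hq⟩ := inc_exists DD μ (fun S hS => ih _ hS (hS.trans hμl) S rfl)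
    (fun k => (e k : ∀ i, X i))
  have hfin : ∀ g : ∀ i, X i, (∀ D ∈ DD, ∀ k, ∀ᶠ i in (D : Filter ι), q k i ≤ g i) →
      ∀ D ∈ DD, ∀ f ∈ S, ∀ᶠ i in (D : Filter ι), f i ≤ g i := by
    intro g hg D hD f hf
    filter_upwards [hg D hD (e.symm ⟨f, hf⟩)] with i hi
    refine le_trans ?_ hi
    have := hpq (e.symm ⟨f, hf⟩) i
    simpa using this
  by_cases hC : ∃ C : Set μ.ord.ToType, #C ≤ θ ∧ ∀ k, ∃ x ∈ C, k ≤ x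
  · obtain ⟨C, hCθ, hC⟩ := hC
    have hlt : #(q '' C) < μ := mk_image_le.trans_lt (hCθ.trans_lt hμ)
    obtain ⟨g, hg⟩ := ih _ hlt (hlt.trans hμl) (q '' C) rfl
    refine ⟨g, hfin g fun D hD k => ?_⟩
    obtain ⟨x, hx, hkx⟩ := hC k
    filter_upwards [hg D hD _ ⟨x, hx, rfl⟩, hq x k hkx D hD] with i h1 h2
    exact h2.trans h1
  push Not at hC
  by_contra hno
  have hstep : ∀ g : ∀ i, X i, ∃ (n : ∀ i, X i) (D : Ultrafilter ι) (k : μ.ord.ToType),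
      D ∈ DD ∧ (¬ ∀ᶠ i in (D : Filter ι), q k i ≤ g i) ∧ g ≤ n ∧
        ∀ k, ∀ᶠ i in (D : Filter ι), q k i ≤ n i := by
    intro g
    have : ∃ D ∈ DD, ∃ k, ¬ ∀ᶠ i in (D : Filter ι), q k i ≤ g i := by
      by_contra! hcon
      exact hno ⟨g, hfin g hcon⟩
    obtain ⟨D, hD, k, hk⟩ := this
    obtain ⟨n, hn⟩ := h2 D hD (Set.range q)
      (mk_range_le.trans_lt (by rw [mk_ord_toType]; exact hμl))
    refine ⟨g ⊔ n, D, k, hD, hk, le_sup_left, fun k => ?_⟩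
    filter_upwards [hn _ ⟨k, rfl⟩] with i hi
    exact hi.trans le_sup_right
  choose next DD' kk hDD hkk hnext hnk using hstep
  obtain ⟨g, hg⟩ := chain_exists θ (small_bdd hc hθc) next
  obtain ⟨ks, hks⟩ := hC (Set.range fun α => kk (g α))
    (mk_range_le.trans (by rw [mk_ord_toType]))
  have hpick : ∀ α, ∃ i, g α i < q ks i ∧ q ks i ≤ next (g α) i := by
    intro α
    have h3 := Ultrafilter.eventually_not.2 (hkk (g α))
    have h4 := hq ks _ (hks _ ⟨α, rfl⟩).le _ (hDD (g α))
    have h5 := hnk (g α) ks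
    obtain ⟨i, hi3, hi4, hi5⟩ := (h3.and (h4.and h5)).exists
    exact ⟨i, (not_le.1 hi3).trans_le hi4, hi5⟩
  choose pick hp1 hp2 using hpick
  refine no_inj hν pick fun α β hβ heq => ?_
  have h3 := (hp2 β).trans (hg α β hβ _)
  rw [heq] at h3
  exact absurd (hp1 α) (not_lt.2 h3)

/-- Universal cofinal families. -/
theorem univ_exists (hc : ∀ i (S : Set (X i)), #S < c i → ∃ x, ∀ s ∈ S, s < x)
    (hpos : ∀ i, 0 < c i) (hθc : ∀ i, θ ≤ c i) (hν : #ι < θ)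
    (DD : Set (Ultrafilter ι)) (l : Cardinal.{u}) (hθl : θ < l)
    (h1 : ∀ D ∈ DD, ∀ᶠ i in (D : Filter ι), θ < c i)
    (h2 : ∀ D ∈ DD, ∀ S : Set (∀ i, X i), #S < l →
      ∃ g : ∀ i, X i, ∀ f ∈ S, ∀ᶠ i in (D : Filter ι), f i ≤ g i)
    (h3 : ∀ D ∈ DD, ∃ S : Set (∀ i, X i), #S = l ∧
      ∀ f : ∀ i, X i, ∃ g ∈ S, ∀ᶠ i in (D : Filter ι), f i ≤ g i)
    (h4 : ∀ D ∈ DD, ∀ S : Set (∀ i, X i), #S < l →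
      ∃ f : ∀ i, X i, ∀ g ∈ S, ¬ ∀ᶠ i in (D : Filter ι), f i ≤ g i) :
    ∃ S : Set (∀ i, X i), #S ≤ l ∧ ∀ D ∈ DD,
      ∀ f : ∀ i, X i, ∃ g ∈ S, ∀ᶠ i in (D : Filter ι), f i ≤ g i := by
  have hdir := dir_exists hc hpos hθc hν DD l h1 h2
  have hinc := inc_exists DD l hdir
  have h3' : ∀ D ∈ DD, ∃ e : l.ord.ToType → ∀ i, X i,
      ∀ f : ∀ i, X i, ∃ k, ∀ᶠ i in (D : Filter ι), f i ≤ e k i := by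
    intro D hD
    obtain ⟨S, hS, hcof⟩ := h3 D hD
    obtain ⟨e⟩ : Nonempty (l.ord.ToType ≃ S) := by
      apply Cardinal.eq.1; rw [mk_ord_toType, hS]
    refine ⟨fun k => e k, fun f => ?_⟩
    obtain ⟨g, hg, hfg⟩ := hcof f
    exact ⟨e.symm ⟨g, hg⟩, by simpa using hfg⟩
  rcases DD.eq_empty_or_nonempty with hemp | ⟨D0, hD0⟩
  · exact ⟨∅, by simp, by simp [hemp]⟩
  -- small subsets of the index order are bounded
  have hC : ∀ C : Set l.ord.ToType, #C ≤ θ → ∃ k, ∀ x ∈ C, x < k := by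
    by_contra! hcon
    obtain ⟨C, hCθ, hC⟩ := hcon
    obtain ⟨e, he⟩ := h3' D0 hD0
    obtain ⟨q, hpq, hq⟩ := hinc e
    obtain ⟨f, hf⟩ := h4 D0 hD0 (q '' C) (mk_image_le.trans_lt (hCθ.trans_lt hθl))
    obtain ⟨k, hk⟩ := he f
    obtain ⟨x, hx, hkx⟩ := hC k
    refine hf _ ⟨x, hx, rfl⟩ ?_
    filter_upwards [hk, hq x k hkx D0 hD0] with i hi1 hi2
    exact (hi1.trans (hpq k i)).trans hi2
  by_contra hno
  let Y := {q : l.ord.ToType → ∀ i, X i //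
    ∀ k m, m ≤ k → ∀ D ∈ DD, ∀ᶠ i in (D : Filter ι), q m i ≤ q k i}
  have hstep : ∀ q : Y, ∃ (n : Y) (D : Ultrafilter ι) (h : ∀ i, X i), D ∈ DD ∧
      (∀ k, ¬ ∀ᶠ i in (D : Filter ι), h i ≤ q.1 k i) ∧ q ≤ n ∧
      (∀ f : ∀ i, X i, ∃ k, ∀ᶠ i in (D : Filter ι), f i ≤ n.1 k i) := by
    rintro ⟨q, hq⟩
    have : ∃ D ∈ DD, ∃ h : ∀ i, X i, ∀ k, ¬ ∀ᶠ i in (D : Filter ι), h i ≤ q k i := by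
      by_contra! hcon
      refine hno ⟨Set.range q, mk_range_le.trans (by rw [mk_ord_toType]), fun D hD f => ?_⟩
      obtain ⟨k, hk⟩ := hcon D hD f
      exact ⟨_, ⟨k, rfl⟩, hk⟩
    obtain ⟨D, hD, h, hh⟩ := this
    obtain ⟨e, he⟩ := h3' D hD
    obtain ⟨n, hpn, hn⟩ := hinc (fun k => q k ⊔ e k)
    refine ⟨⟨n, hn⟩, D, h, hD, hh, fun k => le_sup_left.trans (hpn k), fun f => ?_⟩
    obtain ⟨k, hk⟩ := he f
    refine ⟨k, ?_⟩
    filter_upwards [hk] with i hi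
    exact hi.trans (le_sup_right.trans (hpn k i))
  choose next Dq hq' hDq hbd hnext hcof using hstep
  have hY : ∀ S : Set Y, #S < θ → ∃ y, ∀ s ∈ S, s ≤ y := by
    intro S hS
    have : ∀ k, ∃ g : ∀ i, X i, ∀ f ∈ (fun s : Y => s.1 k) '' S, f ≤ g := fun k =>
      small_bdd hc hθc _ (mk_image_le.trans_lt hS)
    choose p hp using this
    obtain ⟨n, hpn, hn⟩ := hinc p
    exact ⟨⟨n, hn⟩, fun s hs k => (hp k _ ⟨s, hs, rfl⟩).trans (hpn k)⟩
  obtain ⟨g, hg⟩ := chain_exists θ hY next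
  obtain ⟨hs, hhs⟩ := small_bdd' (θ := θ) hc hpos (Set.range fun α => hq' (g α))
    (mk_range_le.trans (by rw [mk_ord_toType]))
  choose kk hkk using fun α => hcof (g α) hs
  obtain ⟨ks, hks⟩ := hC (Set.range kk) (mk_range_le.trans (by rw [mk_ord_toType]))
  have hpick : ∀ α, ∃ i, (g α).1 ks i < hs i ∧ hs i ≤ (next (g α)).1 ks i := by
    intro α
    have e1 := Ultrafilter.eventually_not.2 (hbd (g α) ks)
    have e2 := h1 _ (hDq (g α))
    have e3 := (next (g α)).2 ks _ (hks _ ⟨α, rfl⟩).le _ (hDq (g α))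
    obtain ⟨i, i1, i2, i3, i4⟩ := (e1.and (e2.and (e3.and (hkk α)))).exists
    exact ⟨i, (not_le.1 i1).trans (hhs _ ⟨α, rfl⟩ i i2), i4.trans i3⟩
  choose pick hp1 hp2 using hpick
  refine no_inj hν pick fun α β hβ heq => ?_
  have e1 := (hp2 β).trans (hg α β hβ ks _)
  rw [heq] at e1
  exact absurd (hp1 α) (not_lt.2 e1)

/-- Cofinality of the ultraproduct. -/
noncomputable def cfU (X : ι → Type u) [∀ i, LinearOrder (X i)] (D : Ultrafilter ι) :
    Cardinal.{u} :=
  sInf {m | ∃ S : Set (∀ i, X i), #S = m ∧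
    ∀ f : ∀ i, X i, ∃ g ∈ S, ∀ᶠ i in (D : Filter ι), f i ≤ g i}

theorem cfU_spec (D : Ultrafilter ι) : ∃ S : Set (∀ i, X i), #S = cfU X D ∧
    ∀ f : ∀ i, X i, ∃ g ∈ S, ∀ᶠ i in (D : Filter ι), f i ≤ g i := by
  have : cfU X D ∈ {m | ∃ S : Set (∀ i, X i), #S = m ∧
      ∀ f : ∀ i, X i, ∃ g ∈ S, ∀ᶠ i in (D : Filter ι), f i ≤ g i} :=
    csInf_mem ⟨_, Set.univ, rfl, fun f => ⟨f, trivial, Filter.Eventually.of_forall fun _ => le_rfl⟩⟩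
  exact this

theorem cfU_not (D : Ultrafilter ι) (S : Set (∀ i, X i)) (hS : #S < cfU X D) :
    ∃ f : ∀ i, X i, ∀ g ∈ S, ¬ ∀ᶠ i in (D : Filter ι), f i ≤ g i := by
  by_contra! hcon
  exact absurd hS (not_lt.2 (csInf_le' ⟨S, rfl, hcon⟩))

theorem cfU_bdd (D : Ultrafilter ι) (S : Set (∀ i, X i)) (hS : #S < cfU X D) :
    ∃ g : ∀ i, X i, ∀ f ∈ S, ∀ᶠ i in (D : Filter ι), f i ≤ g i := by
  obtain ⟨f, hf⟩ := cfU_not D S hS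
  refine ⟨f, fun g hg => ?_⟩
  filter_upwards [Ultrafilter.eventually_not.2 (hf g hg)] with i hi
  exact (not_le.1 hi).le

theorem abstract_main (hc : ∀ i (S : Set (X i)), #S < c i → ∃ x, ∀ s ∈ S, s < x)
    (hθ : ℵ₀ ≤ θ) (hθc : ∀ i, θ ≤ c i) (hν : #ι < θ)
    (κ β : Cardinal.{u}) (hκ : κ.IsRegular) (hθκ : θ < κ) (hβ : β < κ)
    (hcf : ∀ D : Ultrafilter ι, cfU X D ≤ β ∨ κ < cfU X D)
    (hstar : ∃ S : Set (∀ i, X i), #S < κ ∧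
      ∀ f : ∀ i, X i, ∃ g ∈ S, ∀ i, c i ≤ θ → f i ≤ g i)
    (F : Set (∀ i, X i)) (hF : #F = κ) :
    ∃ F₀ ⊆ F, #F₀ = κ ∧ ∃ h : ∀ i, X i, ∀ f ∈ F₀, f ≤ h := by
  have hpos : ∀ i, 0 < c i := fun i => (aleph0_pos.trans_le hθ).trans_le (hθc i)
  obtain ⟨Ss, hSs, hSs'⟩ := hstar
  -- the bound for large cofinalities
  obtain ⟨g, hg⟩ := dir_exists hc hpos hθc hν
    {D | (∀ᶠ i in (D : Filter ι), θ < c i) ∧ κ < cfU X D} (Order.succ κ)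
    (fun D hD => hD.1)
    (fun D hD S hS => cfU_bdd D S ((Order.lt_succ_iff.1 hS).trans_lt hD.2))
    F (by rw [hF]; exact Order.lt_succ κ)
  -- universal families
  have huniv : ∀ l : Cardinal.{u}, ∃ S : Set (∀ i, X i), #S ≤ l ∧
      ∀ D : Ultrafilter ι, (∀ᶠ i in (D : Filter ι), θ < c i) → cfU X D = l →
      ∀ f : ∀ i, X i, ∃ g ∈ S, ∀ᶠ i in (D : Filter ι), f i ≤ g i := by
    intro l
    rcases le_or_gt l θ with hl | hl
    · refine ⟨∅, by simp, fun D hD hDl => ?_⟩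
      exfalso
      obtain ⟨S, hS, hcof⟩ := cfU_spec (X := X) D
      obtain ⟨h, hh⟩ := small_bdd' (θ := θ) hc hpos S (by rw [hS, hDl]; exact hl)
      obtain ⟨s, hs, hsD⟩ := hcof h
      obtain ⟨i, hi1, hi2⟩ := (hsD.and hD).exists
      exact absurd (hh s hs i hi2) (not_lt.2 hi1)
    · obtain ⟨S, hS, hS'⟩ := univ_exists (X := X) hc hpos hθc hν
        {D | (∀ᶠ i in (D : Filter ι), θ < c i) ∧ cfU X D = l} l hl (fun D hD => hD.1)
        (fun D hD S hS => cfU_bdd D S (hS.trans_eq hD.2.symm))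
        (fun D hD => by
          obtain ⟨S, hS, h⟩ := cfU_spec (X := X) D
          exact ⟨S, hS.trans hD.2, h⟩)
        (fun D hD S hS => cfU_not D S (hS.trans_eq hD.2.symm))
      exact ⟨S, hS, fun D h1 h2 => hS' D ⟨h1, h2⟩⟩
  choose U hU1 hU2 using huniv
  let W := (β.ord + 1).ToType
  let r : W → Cardinal.{u} := fun w => (Ordinal.ToType.mk.symm w : Ordinal).card
  have hr : ∀ w, r w ≤ β := by
    intro w
    have := (Ordinal.ToType.mk.symm w).2
    have h2 : (Ordinal.ToType.mk.symm w : Ordinal) ≤ β.ord := Order.lt_add_one_iff.1 this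
    simpa using Ordinal.card_le_card h2
  have hrs : ∀ l ≤ β, ∃ w, r w = l := by
    intro l hl
    refine ⟨Ordinal.ToType.mk ⟨l.ord, Order.lt_add_one_iff.2 (ord_le_ord.2 hl)⟩, ?_⟩
    simp [r]
  have hW : #W < κ := by
    have : #W = β + 1 := by simp [W]
    rw [this]
    exact add_lt_of_lt hκ.aleph0_le hβ (one_lt_aleph0.trans_le hκ.aleph0_le)
  let H0 : Set (∀ i, X i) := Ss ∪ ⋃ w : W, U (r w)
  have hH0 : #H0 < κ := by
    refine (mk_union_le _ _).trans_lt (add_lt_of_lt hκ.aleph0_le hSs ?_)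
    refine (mk_iUnion_le_sum_mk).trans_lt ?_
    refine (sum_le_sum _ (fun _ => β) fun w => (hU1 _).trans (hr w)).trans_lt ?_
    rw [sum_const']
    exact mul_lt_of_lt hκ.aleph0_le hW hβ
  have hL : #(List H0) < κ := (mk_list_le_max _).trans_lt (max_lt (hθ.trans_lt hθκ) hH0)
  let sp : List H0 → ∀ i, X i := fun L => L.foldr (fun h x => h.1 ⊔ x) g
  have hsp1 : ∀ L : List H0, g ≤ sp L := by
    intro L
    induction L with
    | nil => exact le_rfl
    | cons a L ih => exact ih.trans le_sup_right
  have hsp2 : ∀ (L : List H0) (h : H0), h ∈ L → h.1 ≤ sp L := by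
    intro L
    induction L with
    | nil => intro h hh; simp at hh
    | cons a L ih =>
      intro h hh
      rcases List.mem_cons.1 hh with rfl | hh
      · exact le_sup_left
      · exact (ih h hh).trans le_sup_right
  have hsp3 : ∀ (L : List H0) (y : ∀ i, X i), g ≤ y → (∀ h ∈ L, h.1 ≤ y) → sp L ≤ y := by
    intro L y hy
    induction L with
    | nil => intro _; exact hy
    | cons a L ih =>
      intro hh
      exact sup_le (hh a (by simp)) (ih fun h hL => hh h (by simp [hL]))
  have hcover : ∀ f : F, ∃ L : List H0, f.1 ≤ sp L := by
    rintro ⟨f, hf⟩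
    by_contra! hcon
    let B : List H0 → Set ι := fun L => {i | sp L i < f i}
    have hB : ∀ L, (B L).Nonempty := by
      intro L
      have := hcon L
      rw [Pi.le_def] at this
      push Not at this
      exact this
    have hne : (⨅ L, Filter.principal (B L)).NeBot := by
      refine Filter.iInf_neBot_of_directed' ?_ fun L => Filter.principal_neBot_iff.2 (hB L)
      intro L M
      refine ⟨L ++ M, ?_, ?_⟩
      · refine Filter.principal_mono.2 fun i hi => lt_of_le_of_lt ?_ hi
        exact hsp3 L _ (hsp1 _) (fun h hh => hsp2 _ h (by simp [hh])) i
      · refine Filter.principal_mono.2 fun i hi => lt_of_le_of_lt ?_ hi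
        exact hsp3 M _ (hsp1 _) (fun h hh => hsp2 _ h (by simp [hh])) i
    let D : Ultrafilter ι := Ultrafilter.of (⨅ L, Filter.principal (B L))
    have hD : ∀ L, ∀ᶠ i in (D : Filter ι), sp L i < f i := fun L =>
      (Ultrafilter.of_le _) (Filter.mem_iInf_of_mem L (Filter.mem_principal_self _))
    have hDh : ∀ h ∈ H0, ¬ ∀ᶠ i in (D : Filter ι), f i ≤ h i := by
      intro h hh hev
      obtain ⟨i, hi1, hi2⟩ := (hev.and (hD [⟨h, hh⟩])).exists
      exact absurd (hi1.trans (hsp2 [⟨h, hh⟩] ⟨h, hh⟩ (by simp) i)) (not_le.2 hi2)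
    by_cases hDθ : ∀ᶠ i in (D : Filter ι), θ < c i
    · rcases hcf D with h | h
      · obtain ⟨w, hw⟩ := hrs _ h
        obtain ⟨y, hy, hyD⟩ := hU2 _ D hDθ rfl f
        exact hDh y (Or.inr (Set.mem_iUnion.2 ⟨w, by rw [hw]; exact hy⟩)) hyD
      · obtain ⟨i, hi1, hi2⟩ := ((hg D ⟨hDθ, h⟩ f hf).and (hD [])).exists
        exact absurd hi1 (not_le.2 hi2)
    · obtain ⟨y, hy, hy'⟩ := hSs' f
      refine hDh y (Or.inl hy) ?_
      filter_upwards [Ultrafilter.eventually_not.2 hDθ] with i hi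
      exact hy' i (not_lt.1 hi)
  choose LL hLL using hcover
  obtain ⟨L, hLκ⟩ := infinite_pigeonhole_card LL κ hF.ge hκ.aleph0_le (by rw [hκ.cof_ord]; exact hL)
  refine ⟨Subtype.val '' (LL ⁻¹' {L}), by rintro _ ⟨x, -, rfl⟩; exact x.2, ?_, sp L, ?_⟩
  · rw [mk_image_eq Subtype.val_injective]
    refine le_antisymm ?_ hLκ
    rw [← hF]
    exact mk_set_le _
  · rintro _ ⟨x, hx, rfl⟩
    have : LL x = L := hx
    rw [← this]
    exact hLL x

end Abstract

theorem X_bdd (a : Cardinal.{0}) (ha : a.IsRegular) (S : Set (Set.Iio a.ord))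
    (hS : #S < Cardinal.lift.{1} a) : ∃ x, ∀ s ∈ S, s < x := by
  have h := Ordinal.sSup_add_one_lt_of_lt_cof (s := Subtype.val '' S) (a := a.ord)
    (by rw [← Ordinal.lift_cof, ha.cof_ord]; exact mk_image_le.trans_lt hS)
    (by rintro _ ⟨x, -, rfl⟩; exact x.2)
  refine ⟨⟨_, h⟩, fun s hs => ?_⟩
  have hb : BddAbove ((· + 1) '' (Subtype.val '' S) : Set Ordinal.{0}) := by
    refine ⟨a.ord, ?_⟩
    rintro _ ⟨_, ⟨x, -, rfl⟩, rfl⟩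
    exact Order.add_one_le_of_lt x.2
  have : s.1 + 1 ≤ sSup ((· + 1) '' (Subtype.val '' S)) := le_csSup hb ⟨_, ⟨s, hs, rfl⟩, rfl⟩
  have h2 : s.1 < sSup ((· + 1) '' (Subtype.val '' S)) := Order.add_one_le_iff.1 this
  exact h2

theorem cofUlt_eq (A : Set Cardinal.{0}) (D : Ultrafilter ↥A) :
    cofUlt A D = cfU (fun a : ↥A => Set.Iio (a : Cardinal).ord) D := by
  unfold cofUlt cfU
  congr 1
  ext m
  constructor
  · rintro ⟨S, hS, rfl, hcof⟩
    let φ : S → ∀ a : ↥A, Set.Iio (a : Cardinal).ord := fun s a => ⟨s.1 a, hS s.2 a⟩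
    have hφ : Function.Injective φ := by
      intro s t hst
      ext a
      exact congrArg Subtype.val (congrFun hst a)
    refine ⟨Set.range φ, mk_range_eq _ hφ, fun f => ?_⟩
    obtain ⟨g, hg, hfg⟩ := hcof (fun a => (f a).1) (fun a => (f a).2)
    exact ⟨φ ⟨g, hg⟩, ⟨_, rfl⟩, hfg⟩
  · rintro ⟨S, rfl, hcof⟩
    let ψ : (∀ a : ↥A, Set.Iio (a : Cardinal).ord) → ↥A → Ordinal.{0} := fun s a => (s a).1
    have hψ : Function.Injective ψ := by
      intro s t hst
      ext a
      exact congrFun hst a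
    refine ⟨ψ '' S, by rintro _ ⟨s, -, rfl⟩ a; exact (s a).2, mk_image_eq hψ, fun f hf => ?_⟩
    obtain ⟨g, hg, hfg⟩ := hcof (fun a => ⟨f a, hf a⟩)
    exact ⟨ψ g, ⟨g, hg, rfl⟩, hfg⟩

theorem mk_X (a : Cardinal.{0}) : #(Set.Iio a.ord) = Cardinal.lift.{1} a := by
  rw [mk_Iio_ordinal, card_ord]

/-- The constant functions with value below the minimum of `A`. -/
theorem const_family (A : Set Cardinal.{0}) (m : Cardinal.{0}) (hm : ∀ a ∈ A, m ≤ a) :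
    ∃ S : Set (∀ a : ↥A, Set.Iio (a : Cardinal).ord), #S ≤ Cardinal.lift.{1} m ∧
      ∀ f : ∀ a : ↥A, Set.Iio (a : Cardinal).ord, ∀ a : ↥A, (a : Cardinal) = m →
        ∃ g ∈ S, f a ≤ g a := by
  let φ : Set.Iio m.ord → ∀ a : ↥A, Set.Iio (a : Cardinal).ord := fun o a =>
    ⟨o.1, lt_of_lt_of_le o.2 (ord_le_ord.2 (hm a a.2))⟩
  refine ⟨Set.range φ, mk_range_le.trans (mk_X m).le, fun f a ha => ?_⟩
  exact ⟨φ ⟨(f a).1, by rw [← ha]; exact (f a).2⟩, ⟨_, rfl⟩, le_rfl⟩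

theorem min_mem_pcf (A : Set Cardinal.{0}) (hA : ∀ a ∈ A, a.IsRegular) (m : Cardinal.{0})
    (hmA : m ∈ A) (hm : ∀ a ∈ A, m ≤ a) : m ∈ pcf A := by
  refine ⟨pure ⟨m, hmA⟩, ?_⟩
  rw [cofUlt_eq]
  apply le_antisymm
  · by_contra! hlt
    obtain ⟨S, hS, hcof⟩ := cfU_spec (X := fun a : ↥A => Set.Iio (a : Cardinal).ord)
      (pure ⟨m, hmA⟩)
    obtain ⟨x, hx⟩ := X_bdd m (hA m hmA) ((fun f => f ⟨m, hmA⟩) '' S)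
      (mk_image_le.trans_lt (by rw [hS]; exact hlt))
    have h0 : ∀ a ∈ A, (0 : Ordinal) < a.ord := fun a ha => (hA a ha).ord_pos
    obtain ⟨g, hg, hfg⟩ := hcof (fun a => ⟨x.1, lt_of_lt_of_le x.2 (ord_le_ord.2 (hm a a.2))⟩)
    have h1 : x ≤ g ⟨m, hmA⟩ := by simpa using hfg
    exact absurd (hx _ ⟨g, hg, rfl⟩) (not_lt.2 h1)
  · obtain ⟨S, hS, hS'⟩ := const_family A m hm
    refine le_trans (csInf_le' ⟨S, rfl, fun f => ?_⟩) hS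
    obtain ⟨g, hg, h⟩ := hS' f ⟨m, hmA⟩ rfl
    exact ⟨g, hg, by simpa using h⟩

/-- If `A` is a progressive set of infinite regular cardinals
(`|A| < min A`), then `spec(A) ⊆ pcf(A) ∪ lim(pcf(A))`. -/
theorem statement5 (A : Set Cardinal.{0}) (hA : ∀ a ∈ A, a.IsRegular)
    (hne : A.Nonempty) (hprog : #A < Cardinal.lift.{1} (sInf A)) :
    spec A ⊆ pcf A ∪ {κ | IsLimitPt (pcf A) κ} := by
  rintro κ ⟨hκ, F, hFA, hF, hFun⟩
  set m := sInf A with hmdef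
  have hmA : m ∈ A := csInf_mem hne
  have hm : ∀ a ∈ A, m ≤ a := fun a ha => csInf_le' ha
  by_contra hcon
  rw [Set.mem_union, not_or] at hcon
  obtain ⟨hpcf, hlim⟩ := hcon
  have hmκ : m ≠ κ := fun h => hpcf (h ▸ min_mem_pcf A hA m hmA hm)
  let X : ↥A → Type 1 := fun a => Set.Iio (a : Cardinal).ord
  let c : ↥A → Cardinal.{1} := fun a => Cardinal.lift.{1} (a : Cardinal)
  have hc : ∀ i (S : Set (X i)), #S < c i → ∃ x, ∀ s ∈ S, s < x :=
    fun i S hS => X_bdd i (hA i i.2) S hS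
  let ψ : (∀ a, X a) → ↥A → Ordinal.{0} := fun s a => (s a).1
  have hψ : Function.Injective ψ := by
    intro s t hst
    ext a
    exact congrFun hst a
  have hψr : ψ '' (ψ ⁻¹' F) = F := by
    apply Set.image_preimage_eq_of_subset
    intro f hf
    exact ⟨fun a => ⟨f a, hFA hf a⟩, rfl⟩
  have hF' : #(ψ ⁻¹' F : Set (∀ a, X a)) = Cardinal.lift.{1} κ := by
    rw [← hF, ← mk_image_eq (s := ψ ⁻¹' F) hψ, hψr]
  suffices H : ∃ F₀ ⊆ ψ ⁻¹' F, #F₀ = Cardinal.lift.{1} κ ∧ ∃ h : ∀ i, X i, ∀ f ∈ F₀, f ≤ h by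
    obtain ⟨F₀, hF₀, hcard, h, hh⟩ := H
    refine hFun (ψ '' F₀) (by rintro _ ⟨f, hf, rfl⟩; exact hF₀ hf)
      (by rw [mk_image_eq hψ, hcard]) ⟨ψ h, fun a => (h a).2, ?_⟩
    rintro _ ⟨f, hf, rfl⟩ a
    exact hh f hf a
  rcases lt_or_gt_of_ne hmκ with hlt | hlt
  · simp only [Set.mem_ofPred_eq, IsLimitPt] at hlim
    push Not at hlim
    obtain ⟨β, hβ, hβ'⟩ := hlim
    let θ : Cardinal.{1} := max ℵ₀ (Order.succ #A)
    have hθm : θ ≤ Cardinal.lift.{1} m := by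
      refine max_le ?_ (Order.succ_le_of_lt hprog)
      simpa using (hA m hmA).aleph0_le
    have hreg : (Cardinal.lift.{1} κ).IsRegular := by
      refine ⟨by simpa using hκ.aleph0_le, ?_⟩
      rw [← lift_ord, ← Ordinal.lift_cof, hκ.cof_ord]
    refine abstract_main (θ := θ) hc (le_max_left _ _)
      (fun i => hθm.trans (Cardinal.lift_le.2 (hm i i.2)))
      ((Order.lt_succ _).trans_le (le_max_right _ _)) (Cardinal.lift.{1} κ) (Cardinal.lift.{1} β)
      hreg (hθm.trans_lt (Cardinal.lift_lt.2 hlt)) (Cardinal.lift_lt.2 hβ) ?_ ?_ _ hF'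
    · intro D
      by_contra! hD
      obtain ⟨x, hx⟩ := Cardinal.mem_range_lift_of_le hD.2
      have hxp : x ∈ pcf A := ⟨D, by rw [hx, cofUlt_eq]⟩
      have h1 : β < x := by rw [← Cardinal.lift_lt.{0, 1}, hx]; exact hD.1
      have h2 : x ≤ κ := by rw [← Cardinal.lift_le.{1, 0}, hx]; exact hD.2
      have h3 : x = κ := le_antisymm h2 (hβ' x hxp h1)
      exact hpcf (h3 ▸ hxp)
    · obtain ⟨S, hS, hS'⟩ := const_family A m hm
      refine ⟨S, hS.trans_lt (Cardinal.lift_lt.2 hlt), fun f => ?_⟩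
      obtain ⟨g, hg, hfg⟩ := hS' f ⟨m, hmA⟩ rfl
      refine ⟨g, hg, fun i hi => ?_⟩
      have h1 : (i : Cardinal) ≤ m := Cardinal.lift_le.1 (hi.trans hθm)
      have h2 : i = ⟨m, hmA⟩ := Subtype.ext (le_antisymm h1 (hm i i.2))
      rw [h2]
      exact hfg
  · refine ⟨_, subset_rfl, hF', ?_⟩
    exact small_bdd (θ := Cardinal.lift.{1} m) hc (fun i => Cardinal.lift_le.2 (hm i i.2)) _
      (by rw [hF']; exact Cardinal.lift_lt.2 hlt)

end TukeySpec
end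

section
/- Let A be a progressive set of infinite regular cardinals (|A| < min(A)), and suppose that every regular cardinal that is a limit point of pcf(A) belongs to pcf(A). Then pcf(A) = spec(A). -/
universe u

open Cardinal Set

namespace TukeySpec

/-! ### Helper lemmas -/

theorem reg_bdd {c : Cardinal.{0}} (hc : c.IsRegular) (T : Set Ordinal.{0})
    (hT : ∀ t ∈ T, t < c.ord) (hcard : #T < Cardinal.lift.{1} c) :
    ∃ β < c.ord, ∀ t ∈ T, t < β := by
  have h1 : #T < (Ordinal.lift.{1} c.ord).cof := by
    rw [← Ordinal.lift_cof, hc.cof_ord]; exact hcard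
  refine ⟨_, Ordinal.sSup_add_one_lt_of_lt_cof h1 hT, fun t ht => ?_⟩
  have hb : BddAbove ((· + 1) '' T) := by
    refine ⟨c.ord, ?_⟩
    rintro _ ⟨x, hx, rfl⟩
    exact Order.add_one_le_of_lt (hT x hx)
  exact (Order.lt_add_one_iff.2 le_rfl).trans_le (le_csSup hb ⟨t, ht, rfl⟩)

open Classical in
/-- A pointwise bound of `S`, at those coordinates where `S` is small enough. -/
noncomputable def supf (A : Set Cardinal.{0}) (S : Set (↥A → Ordinal.{0})) : ↥A → Ordinal.{0} :=
  fun a => if h : ∃ β < (a : Cardinal).ord, ∀ f ∈ S, f a < β then h.choose else 0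

theorem ord_pos_of {A : Set Cardinal.{0}} (hA : ∀ a ∈ A, a.IsRegular) (a : ↥A) :
    0 < (a : Cardinal).ord := by
  rw [Cardinal.lt_ord]
  simpa using (hA a a.2).pos

theorem supf_mem {A : Set Cardinal.{0}} (hA : ∀ a ∈ A, a.IsRegular)
    (S : Set (↥A → Ordinal.{0})) : supf A S ∈ piSet A := by
  intro a
  unfold supf
  split_ifs with h
  · exact h.choose_spec.1
  · exact ord_pos_of hA a

theorem lt_supf {A : Set Cardinal.{0}} (hA : ∀ a ∈ A, a.IsRegular)
    {S : Set (↥A → Ordinal.{0})} (hS : S ⊆ piSet A) (a : ↥A)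
    (hcard : #S < Cardinal.lift.{1} (a : Cardinal)) {f : ↥A → Ordinal.{0}} (hf : f ∈ S) :
    f a < supf A S a := by
  have h : ∃ β < (a : Cardinal).ord, ∀ f ∈ S, f a < β := by
    obtain ⟨β, hβ, h⟩ := reg_bdd (hA a a.2) ((fun f => f a) '' S)
      (by rintro _ ⟨f, hf, rfl⟩; exact hS hf a) (mk_image_le.trans_lt hcard)
    exact ⟨β, hβ, fun f hf => h _ ⟨f, hf, rfl⟩⟩
  unfold supf
  rw [dif_pos h]
  exact h.choose_spec.2 f hf

theorem max_mem {A : Set Cardinal.{0}} {f g : ↥A → Ordinal.{0}} (hf : f ∈ piSet A)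
    (hg : g ∈ piSet A) : (fun a => max (f a) (g a)) ∈ piSet A :=
  fun a => max_lt (hf a) (hg a)

theorem zero_mem_pi {A : Set Cardinal.{0}} (hA : ∀ a ∈ A, a.IsRegular) :
    (fun _ => 0) ∈ piSet A := fun a => ord_pos_of hA a

theorem succ_mem {A : Set Cardinal.{0}} (hA : ∀ a ∈ A, a.IsRegular) {f : ↥A → Ordinal.{0}}
    (hf : f ∈ piSet A) : (fun a => f a + 1) ∈ piSet A := fun a =>
  (Cardinal.isSuccLimit_ord (hA a a.2).aleph0_le).add_one_lt (hf a)

theorem cofUlt_spec (A : Set Cardinal.{0}) (D : Ultrafilter ↥A) :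
    ∃ S ⊆ piSet A, #S = cofUlt A D ∧ ∀ f ∈ piSet A, ∃ g ∈ S, {a : ↥A | f a ≤ g a} ∈ D := by
  have := csInf_mem (s := {c : Cardinal.{1} | ∃ S ⊆ piSet A, #S = c ∧
    ∀ f ∈ piSet A, ∃ g ∈ S, {a : ↥A | f a ≤ g a} ∈ D}) 
    ⟨_, piSet A, subset_rfl, rfl, fun f hf => ⟨f, hf, by
      filter_upwards with a using le_rfl⟩⟩
  exact this

theorem cofUlt_le {A : Set Cardinal.{0}} (D : Ultrafilter ↥A) {S : Set (↥A → Ordinal.{0})}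
    (hS : S ⊆ piSet A) (h : ∀ f ∈ piSet A, ∃ g ∈ S, {a : ↥A | f a ≤ g a} ∈ D) :
    cofUlt A D ≤ #S :=
  csInf_le' ⟨S, hS, rfl, h⟩

/-- Small families are strictly bounded modulo `D`. -/
theorem bdd_of_lt {A : Set Cardinal.{0}} (D : Ultrafilter ↥A) {S : Set (↥A → Ordinal.{0})}
    (hS : S ⊆ piSet A) (h : #S < cofUlt A D) :
    ∃ g ∈ piSet A, ∀ f ∈ S, {a : ↥A | f a < g a} ∈ D := by
  by_contra! hcon
  refine (cofUlt_le D hS fun f hf => ?_).not_gt h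
  obtain ⟨g, hg, h'⟩ := hcon f hf
  refine ⟨g, hg, ?_⟩
  rw [← Ultrafilter.compl_mem_iff_notMem] at h'
  convert h' using 1
  ext a; simp

theorem aleph0_le_cofUlt {A : Set Cardinal.{0}} (hA : ∀ a ∈ A, a.IsRegular)
    (D : Ultrafilter ↥A) : ℵ₀ ≤ cofUlt A D := by
  obtain ⟨S, hS, hc, hcof⟩ := cofUlt_spec A D
  by_contra! hlt
  obtain ⟨g, hg, h⟩ := hcof (supf A S) (supf_mem hA S)
  obtain ⟨a, ha⟩ := D.nonempty_of_mem h
  refine (lt_supf hA hS a ?_ hg).not_ge ha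
  rw [hc]
  refine hlt.trans_le ?_
  simpa using (hA a a.2).aleph0_le

/-- A scale-like sequence. -/
theorem exists_seq {A : Set Cardinal.{0}} (hA : ∀ a ∈ A, a.IsRegular)
    (D : Ultrafilter ↥A) {θ : Cardinal.{0}} (hθ : Cardinal.lift.{1} θ = cofUlt A D) :
    ∃ k : Ordinal.{0} → ↥A → Ordinal.{0}, (∀ ξ, k ξ ∈ piSet A) ∧
      ∀ h ∈ piSet A, ∃ ξ₀ < θ.ord, ∀ ξ, ξ₀ < ξ → ξ < θ.ord → {a | h a ≤ k ξ a} ∈ D := by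
  obtain ⟨S, hS, hc, hcof⟩ := cofUlt_spec A D
  have he : #(Set.Iio θ.ord) = #S := by
    rw [mk_Iio_ordinal, card_ord, hc, hθ]
  obtain ⟨e⟩ := Cardinal.eq.1 he
  have hk : ∀ ξ : Ordinal.{0}, ∃ g ∈ piSet A, ξ < θ.ord → ∀ η (hη : η < θ.ord), η < ξ →
      {a : ↥A | (e ⟨η, hη⟩ : ↥A → Ordinal.{0}) a ≤ g a} ∈ D := by
    intro ξ
    by_cases hξ : ξ < θ.ord
    · obtain ⟨g, hg, h⟩ := bdd_of_lt D
        (S := {f | ∃ η, ∃ hη : η < θ.ord, η < ξ ∧ (e ⟨η, hη⟩ : ↥A → Ordinal.{0}) = f})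
        (by rintro _ ⟨η, hη, -, rfl⟩; exact hS (e _).2)
        (by
          have : {f | ∃ η, ∃ hη : η < θ.ord, η < ξ ∧ (e ⟨η, hη⟩ : ↥A → Ordinal.{0}) = f} ⊆
              Set.range (fun η : Set.Iio ξ => (e ⟨η, lt_trans η.2 hξ⟩ : ↥A → Ordinal.{0})) := by
            rintro _ ⟨η, hη, h, rfl⟩
            exact ⟨⟨η, h⟩, rfl⟩
          refine ((mk_le_mk_of_subset this).trans mk_range_le).trans_lt ?_
          rw [mk_Iio_ordinal, ← hθ, Cardinal.lift_lt, ← Cardinal.lt_ord]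
          exact hξ)
      refine ⟨g, hg, fun _ η hη hlt => ?_⟩
      filter_upwards [h _ ⟨η, hη, hlt, rfl⟩] with a ha using ha.le
    · exact ⟨_, zero_mem_pi hA, fun h => absurd h hξ⟩
  choose k hk1 hk2 using hk
  refine ⟨k, hk1, fun h hh => ?_⟩
  obtain ⟨g, hg, hD⟩ := hcof h hh
  obtain ⟨⟨ξ₀, hξ₀⟩, he⟩ := e.surjective ⟨g, hg⟩
  refine ⟨ξ₀, hξ₀, fun ξ h1 h2 => ?_⟩
  have := hk2 ξ h2 ξ₀ hξ₀ h1
  rw [he] at this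
  filter_upwards [hD, this] with a ha hb using le_trans ha hb

theorem regular_of_mem_pcf {A : Set Cardinal.{0}} (hA : ∀ a ∈ A, a.IsRegular)
    {θ : Cardinal.{0}} (hθ : θ ∈ pcf A) : θ.IsRegular := by
  obtain ⟨D, hD⟩ := hθ
  have hinf : ℵ₀ ≤ θ := by
    have := aleph0_le_cofUlt hA D
    rw [← hD] at this
    simpa using this
  refine ⟨hinf, ?_⟩
  obtain ⟨k, hk, hcof⟩ := exists_seq hA D hD
  have hlim := Cardinal.isSuccLimit_ord hinf
  rw [← Cardinal.lift_le.{1}, Ordinal.lift_cof, ← Ordinal.cof_Iio, Order.le_cof_iff]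
  intro s hs
  rw [hD]
  refine (cofUlt_le D (S := (fun x : Set.Iio θ.ord => k x) '' s) ?_ ?_).trans mk_image_le
  · rintro _ ⟨x, -, rfl⟩; exact hk _
  · intro f hf
    obtain ⟨ξ₀, h0, h⟩ := hcof f hf
    obtain ⟨x, hx, hle⟩ := hs ⟨ξ₀ + 1, hlim.add_one_lt h0⟩
    exact ⟨_, ⟨x, hx, rfl⟩, h x ((Order.lt_add_one_iff.2 le_rfl).trans_le hle) x.2⟩

theorem pcf_subset_spec {A : Set Cardinal.{0}} (hA : ∀ a ∈ A, a.IsRegular) :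
    pcf A ⊆ spec A := by
  intro θ hθ
  have hreg := regular_of_mem_pcf hA hθ
  refine ⟨hreg, ?_⟩
  obtain ⟨D, hD⟩ := hθ
  obtain ⟨k, hk, hcof⟩ := exists_seq hA D hD
  have hlim := Cardinal.isSuccLimit_ord hreg.aleph0_le
  have hsub : k '' Set.Iio θ.ord ⊆ piSet A := by rintro _ ⟨x, -, rfl⟩; exact hk _
  refine ⟨k '' Set.Iio θ.ord, hsub, ?_, ?_⟩
  · apply le_antisymm
    · refine mk_image_le.trans ?_
      rw [mk_Iio_ordinal, card_ord]
    · rw [hD]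
      refine cofUlt_le D hsub fun f hf => ?_
      obtain ⟨ξ₀, h0, h⟩ := hcof f hf
      have h1 := hlim.add_one_lt h0
      exact ⟨_, ⟨ξ₀ + 1, h1, rfl⟩, h _ (Order.lt_add_one_iff.2 le_rfl) h1⟩
  · rintro F₀ hF₀ hc ⟨h, hh, hb⟩
    obtain ⟨ξ₀, h0, hξ⟩ := hcof _ (succ_mem hA hh)
    have : F₀ ⊆ k '' Set.Iio (ξ₀ + 1) := by
      intro f hf
      obtain ⟨ξ, hξ1, rfl⟩ := hF₀ hf
      refine ⟨ξ, ?_, rfl⟩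
      by_contra hcon
      have hlt : ξ₀ < ξ := by simpa using hcon
      obtain ⟨a, ha⟩ := D.nonempty_of_mem (hξ ξ hlt hξ1)
      have h2 := hb _ hf a
      exact absurd (ha.trans h2) (by simp)
    have h3 := (mk_le_mk_of_subset this).trans mk_image_le
    rw [hc, mk_Iio_ordinal, Cardinal.lift_le] at h3
    exact h3.not_gt (Cardinal.lt_ord.1 (hlim.add_one_lt h0))

theorem cofUlt_pure {A : Set Cardinal.{0}} (hA : ∀ a ∈ A, a.IsRegular) (a : ↥A) :
    cofUlt A (pure a) = Cardinal.lift.{1} (a : Cardinal) := by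
  classical
  apply le_antisymm
  · refine (cofUlt_le (pure a)
      (S := (fun ξ : Ordinal.{0} => fun b : ↥A => if b = a then ξ else 0) ''
        Set.Iio (a : Cardinal).ord) ?_ ?_).trans (mk_image_le.trans ?_)
    · rintro _ ⟨ξ, hξ, rfl⟩ b
      dsimp only
      split_ifs with h
      · rw [h]; exact hξ
      · exact ord_pos_of hA b
    · intro f hf
      refine ⟨_, ⟨f a, hf a, rfl⟩, ?_⟩
      simp
    · rw [mk_Iio_ordinal, card_ord]
  · obtain ⟨S, hS, hc, hcof⟩ := cofUlt_spec A (pure a)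
    by_contra! hlt
    obtain ⟨g, hg, h⟩ := hcof (supf A S) (supf_mem hA S)
    have h' : supf A S a ≤ g a := by simpa using h
    exact (lt_supf hA hS a (hc ▸ hlt) hg).not_ge h'

theorem mem_pcf_of_mem {A : Set Cardinal.{0}} (hA : ∀ a ∈ A, a.IsRegular) {a : Cardinal.{0}}
    (ha : a ∈ A) : a ∈ pcf A := ⟨pure ⟨a, ha⟩, (cofUlt_pure hA ⟨a, ha⟩).symm⟩

theorem eq_pure_of {A : Set Cardinal.{0}} {D : Ultrafilter ↥A} {a : ↥A}
    (h : {b : ↥A | (b : Cardinal) = a} ∈ D) : D = pure a := by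
  have : ({a} : Set ↥A) ∈ D := by
    convert h using 1
    ext b; simp [Subtype.ext_iff]
  rw [← Ultrafilter.coe_le_coe]
  exact Filter.le_pure_iff.2 this

theorem iterate {A : Set Cardinal.{0}} (hA : ∀ a ∈ A, a.IsRegular) {τ : Cardinal.{0}}
    (hτA : ∀ a ∈ A, τ ≤ a) {I : Type 1}
    (step : (I → ↥A → Ordinal.{0}) → (I → ↥A → Ordinal.{0}))
    (hstep : ∀ p, (∀ i, p i ∈ piSet A) → ∀ i, step p i ∈ piSet A) :
    ∃ g : Ordinal.{0} → I → ↥A → Ordinal.{0}, (∀ α i, g α i ∈ piSet A) ∧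
      ∀ α < τ.ord, ∀ β < α, ∀ i a, step (g β) i a ≤ g α i a := by
  let G : Ordinal.{0} → I → ↥A → Ordinal.{0} :=
    WellFounded.fix (r := fun x y : Ordinal.{0} => x < y) wellFounded_lt
      (fun α ih i => supf A {f | ∃ β, ∃ h : β < α, f = step (ih β h) i})
  have hG : ∀ α i, G α i = supf A {f | ∃ β, β < α ∧ f = step (G β) i} := by
    intro α i
    have := congrFun (WellFounded.fix_eq (r := fun x y : Ordinal.{0} => x < y) wellFounded_lt
      (fun α (ih : ∀ β, β < α → I → ↥A → Ordinal.{0}) i =>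
        supf A {f | ∃ β, ∃ h : β < α, f = step (ih β h) i}) α) i
    simp only [exists_prop] at this
    exact this
  have hmem : ∀ α i, G α i ∈ piSet A := fun α i => by rw [hG]; exact supf_mem hA _
  refine ⟨G, hmem, fun α hα β hβ i a => ?_⟩
  rw [hG α]
  refine (lt_supf hA (S := {f | ∃ β, β < α ∧ f = step (G β) i}) ?_ a ?_ ⟨β, hβ, rfl⟩).le
  · rintro _ ⟨γ, -, rfl⟩
    exact hstep _ (hmem γ) i
  · have : {f | ∃ β, β < α ∧ f = step (G β) i} ⊆ (fun β => step (G β) i) '' Set.Iio α := by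
      rintro _ ⟨γ, hγ, rfl⟩
      exact ⟨γ, hγ, rfl⟩
    refine ((mk_le_mk_of_subset this).trans mk_image_le).trans_lt ?_
    rw [mk_Iio_ordinal, Cardinal.lift_lt]
    exact (Cardinal.lt_ord.1 hα).trans_le (hτA a a.2)

/-- There is no injection from `τ = |A|⁺` into `A`. -/
theorem no_inj_s6 {A : Set Cardinal.{0}} {τ : Cardinal.{0}}
    (hτ : Cardinal.lift.{1} τ = Order.succ #A) (x : Ordinal.{0} → ↥A)
    (hx : ∀ β < τ.ord, ∀ α < β, x α ≠ x β) : False := by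
  have hinj : Function.Injective (fun α : Set.Iio τ.ord => x α) := by
    intro α β h
    rcases lt_trichotomy α β with hlt | heq | hlt
    · exact absurd h (hx β β.2 α hlt)
    · exact heq
    · exact absurd h.symm (hx α α.2 β hlt)
  have := mk_le_of_injective hinj
  rw [mk_Iio_ordinal, card_ord, hτ] at this
  exact (Order.lt_succ _).not_ge this

theorem ne_tau_mem {A : Set Cardinal.{0}} (hA : ∀ a ∈ A, a.IsRegular) {τ : Cardinal.{0}}
    {D : Ultrafilter ↥A} (h : Cardinal.lift.{1} τ < cofUlt A D) :
    {a : ↥A | (a : Cardinal) ≠ τ} ∈ D := by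
  by_contra hcon
  rw [← Ultrafilter.compl_mem_iff_notMem] at hcon
  have h1 : {a : ↥A | (a : Cardinal) = τ} ∈ D := by
    convert hcon using 1
    ext a; simp
  obtain ⟨a, rfl⟩ := D.nonempty_of_mem h1
  rw [eq_pure_of h1, cofUlt_pure hA] at h
  exact lt_irrefl _ h

theorem eq_tau_mem {A : Set Cardinal.{0}} (hA : ∀ a ∈ A, a.IsRegular) {τ : Cardinal.{0}}
    (hτA : ∀ a ∈ A, τ ≤ a)
    {D : Ultrafilter ↥A} (h : cofUlt A D ≤ Cardinal.lift.{1} τ) :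
    {a : ↥A | (a : Cardinal) = τ} ∈ D := by
  obtain ⟨S, hS, hc, hcof⟩ := cofUlt_spec A D
  obtain ⟨g, hg, h'⟩ := hcof (supf A S) (supf_mem hA S)
  refine Filter.mem_of_superset h' fun a ha => ?_
  by_contra hne
  refine (lt_supf hA hS a ?_ hg).not_ge ha
  rw [hc]
  refine h.trans_lt ?_
  rw [Cardinal.lift_lt]
  exact lt_of_le_of_ne (hτA a a.2) (Ne.symm hne)

/-- Universal families. -/
theorem universal_big {A : Set Cardinal.{0}} (hA : ∀ a ∈ A, a.IsRegular) {τ : Cardinal.{0}}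
    (hτA : ∀ a ∈ A, τ ≤ a) (hτ : Cardinal.lift.{1} τ = Order.succ #A)
    {θ : Cardinal.{0}} (hθ : θ.IsRegular) (hlt : τ < θ) :
    ∃ U ⊆ piSet A, #U ≤ Cardinal.lift.{1} θ ∧ ∀ D : Ultrafilter ↥A,
      cofUlt A D = Cardinal.lift.{1} θ → ∀ f ∈ piSet A, ∃ u ∈ U, {a | f a ≤ u a} ∈ D := by
  classical
  by_contra! hcon
  have hstep : ∀ p : Ordinal.{0} → ↥A → Ordinal.{0}, ∃ q : Ordinal.{0} → ↥A → Ordinal.{0},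
      ∃ D : Ultrafilter ↥A, (∀ ξ, p ξ ∈ piSet A) → ((∀ ξ, q ξ ∈ piSet A) ∧
        cofUlt A D = Cardinal.lift.{1} θ ∧
        (∀ ξ < θ.ord, {a | p ξ a < q 0 a} ∈ D) ∧
        ∀ h ∈ piSet A, ∃ ξ₀ < θ.ord, ∀ ξ, ξ₀ < ξ → ξ < θ.ord → {a | h a ≤ q ξ a} ∈ D) := by
    intro p
    by_cases hp : ∀ ξ, p ξ ∈ piSet A
    swap
    · obtain ⟨D, -⟩ := hcon ∅ (by simp) (by simp)
      exact ⟨p, D, fun h => absurd h hp⟩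
    obtain ⟨D, hD, g, hg, hU⟩ := hcon (p '' Set.Iio θ.ord)
      (by rintro _ ⟨ξ, -, rfl⟩; exact hp ξ)
      (mk_image_le.trans (by rw [mk_Iio_ordinal, card_ord]))
    obtain ⟨k, hk, hcof⟩ := exists_seq hA D hD.symm
    refine ⟨fun ξ a => max (g a) (k ξ a), D, fun _ => ⟨fun ξ => max_mem hg (hk ξ), hD, ?_, ?_⟩⟩
    · intro ξ hξ
      have h1 := hU (p ξ) ⟨ξ, hξ, rfl⟩
      rw [← Ultrafilter.compl_mem_iff_notMem] at h1
      refine Filter.mem_of_superset h1 fun a ha => ?_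
      have : p ξ a < g a := by simpa using ha
      exact lt_max_of_lt_left this
    · intro h hh
      obtain ⟨ξ₀, h0, h1⟩ := hcof h hh
      refine ⟨ξ₀, h0, fun ξ h2 h3 => ?_⟩
      filter_upwards [h1 ξ h2 h3] with a ha using le_max_of_le_right ha
  choose step Dst hst using hstep
  obtain ⟨g, hg, hmono⟩ := iterate hA hτA step (fun p hp => (hst p hp).1)
  let H : Set (↥A → Ordinal.{0}) := (fun α => step (g α) 0) '' Set.Iio τ.ord
  have hH : H ⊆ piSet A := by
    rintro _ ⟨α, -, rfl⟩
    exact (hst _ (hg α)).1 0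
  have hHc : #H ≤ Cardinal.lift.{1} τ :=
    mk_image_le.trans (by rw [mk_Iio_ordinal, card_ord])
  let h := supf A H
  have hh : h ∈ piSet A := supf_mem hA H
  have hξ : ∀ α, ∃ ξ₀ < θ.ord, ∀ ξ, ξ₀ < ξ → ξ < θ.ord →
      {a | h a ≤ step (g α) ξ a} ∈ Dst (g α) := fun α => (hst _ (hg α)).2.2.2 h hh
  choose x hx hx' using hξ
  obtain ⟨ξ, hξ, hξx⟩ := reg_bdd hθ (x '' Set.Iio τ.ord)
    (by rintro _ ⟨α, -, rfl⟩; exact hx α)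
    (mk_image_le.trans_lt (by rwa [mk_Iio_ordinal, card_ord, Cardinal.lift_lt]))
  have key : ∀ α, ∃ a : ↥A, α < τ.ord → (g α ξ a < h a ∧ h a ≤ step (g α) ξ a) := by
    intro α
    by_cases hα : α < τ.ord
    swap
    · obtain ⟨a, -⟩ := (Dst (g α)).nonempty_of_mem Filter.univ_mem
      exact ⟨a, fun h => absurd h hα⟩
    obtain ⟨-, hD, h2, -⟩ := hst _ (hg α)
    have h3 := hx' α ξ (hξx _ ⟨α, hα, rfl⟩) hξ
    have h4 := ne_tau_mem hA (D := Dst (g α)) (τ := τ) (by rw [hD]; simpa using hlt)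
    obtain ⟨a, ⟨ha1, ha2⟩, ha3⟩ := (Dst (g α)).nonempty_of_mem
      (Filter.inter_mem (Filter.inter_mem (h2 ξ hξ) h3) h4)
    refine ⟨a, fun _ => ⟨lt_trans ha1 (lt_supf hA hH a (hHc.trans_lt ?_) ⟨α, hα, rfl⟩), ha2⟩⟩
    rw [Cardinal.lift_lt]
    exact lt_of_le_of_ne (hτA a a.2) (Ne.symm ha3)
  choose y hy using key
  refine no_inj_s6 hτ y fun β hβ α hαβ heq => ?_
  have h1 := (hy α (hαβ.trans hβ)).2
  have h2 := (hy β hβ).1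
  rw [heq] at h1
  exact (h1.trans (hmono β hβ α hαβ ξ (y β))).not_gt h2

theorem universal {A : Set Cardinal.{0}} (hA : ∀ a ∈ A, a.IsRegular) {τ : Cardinal.{0}}
    (hτA : ∀ a ∈ A, τ ≤ a) (hτ : Cardinal.lift.{1} τ = Order.succ #A)
    (θ : Cardinal.{0}) :
    ∃ U ⊆ piSet A, #U ≤ Cardinal.lift.{1} θ ∧ ∀ D : Ultrafilter ↥A,
      cofUlt A D = Cardinal.lift.{1} θ → ∀ f ∈ piSet A, ∃ u ∈ U, {a | f a ≤ u a} ∈ D := by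
  by_cases hex : ∃ D : Ultrafilter ↥A, Cardinal.lift.{1} θ = cofUlt A D
  swap
  · exact ⟨∅, by simp, by simp, fun D hD => absurd ⟨D, hD.symm⟩ hex⟩
  have hreg := regular_of_mem_pcf hA hex
  rcases lt_or_ge τ θ with hlt | hle
  · exact universal_big hA hτA hτ hreg hlt
  obtain ⟨D, hD⟩ := hex
  obtain ⟨S, hS, hc, hcof⟩ := cofUlt_spec A D
  refine ⟨S, hS, by rw [hc, hD], fun D' hD' => ?_⟩
  have h1 := eq_tau_mem hA hτA (D := D) (by rw [← hD]; simpa using hle)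
  have h2 := eq_tau_mem hA hτA (D := D') (by rw [hD']; simpa using hle)
  obtain ⟨a, rfl⟩ := D.nonempty_of_mem h1
  rw [eq_pure_of h2, ← eq_pure_of h1]
  exact hcof

theorem directed {A : Set Cardinal.{0}} (hA : ∀ a ∈ A, a.IsRegular) {τ : Cardinal.{0}}
    (hτA : ∀ a ∈ A, τ ≤ a) (hτ : Cardinal.lift.{1} τ = Order.succ #A)
    {κ : Cardinal.{0}} (hlt : τ < κ) (δ : Ordinal.{0}) :
    δ ≤ κ.ord → ∀ f : Ordinal.{0} → ↥A → Ordinal.{0}, (∀ ξ, f ξ ∈ piSet A) →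
      ∃ h ∈ piSet A, ∀ ξ < δ, ∀ D : Ultrafilter ↥A, Cardinal.lift.{1} κ < cofUlt A D →
        {a | f ξ a ≤ h a} ∈ D := by
  induction δ using WellFoundedLT.induction with
  | ind δ IH =>
  intro hδ f hf
  have hF : ∀ ξ, ∃ g ∈ piSet A, ξ < δ → ∀ η ≤ ξ, ∀ D : Ultrafilter ↥A,
      Cardinal.lift.{1} κ < cofUlt A D → {a | f η a ≤ g a} ∈ D := by
    intro ξ
    by_cases hξ : ξ < δ
    swap
    · exact ⟨_, zero_mem_pi hA, fun h => absurd h hξ⟩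
    obtain ⟨g, hg, h⟩ := IH ξ hξ (hξ.le.trans hδ) f hf
    refine ⟨_, max_mem hg (hf ξ), fun _ η hη D hD => ?_⟩
    rcases hη.lt_or_eq with hη | rfl
    · filter_upwards [h η hη D hD] with a ha using le_max_of_le_left ha
    · filter_upwards with a using le_max_right _ _
  choose F hFm hFle using hF
  by_cases hC : ∃ C : Set Ordinal.{0}, (∀ ξ ∈ C, ξ < δ) ∧ #C ≤ Cardinal.lift.{1} τ ∧
      ∀ η < δ, ∃ ξ ∈ C, η ≤ ξ
  · obtain ⟨C, hCδ, hCc, hCcof⟩ := hC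
    have hsub : F '' C ⊆ piSet A := by rintro _ ⟨ξ, -, rfl⟩; exact hFm ξ
    refine ⟨supf A (F '' C), supf_mem hA _, fun η hη D hD => ?_⟩
    obtain ⟨ξ, hξ, hle⟩ := hCcof η hη
    have h1 := ne_tau_mem hA (D := D) (τ := τ) (lt_trans (by simpa using hlt) hD)
    filter_upwards [h1, hFle ξ (hCδ ξ hξ) η hle D hD] with a ha hb
    refine hb.trans (lt_supf hA hsub a ((mk_image_le.trans hCc).trans_lt ?_) ⟨ξ, hξ, rfl⟩).le
    rw [Cardinal.lift_lt]
    exact lt_of_le_of_ne (hτA a a.2) (Ne.symm ha)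
  · by_contra! hcon
    have hstep : ∀ p : PUnit.{2} → ↥A → Ordinal.{0}, ∃ q : PUnit.{2} → ↥A → Ordinal.{0},
        ∃ η : Ordinal.{0}, (∀ i, p i ∈ piSet A) → ((∀ i, q i ∈ piSet A) ∧
          η < δ ∧ ∀ ξ < δ, η ≤ ξ → ∃ a, p ⟨⟩ a < F ξ a ∧ F ξ a ≤ q ⟨⟩ a) := by
      intro p
      by_cases hp : ∀ i, p i ∈ piSet A
      swap
      · exact ⟨p, 0, fun h => absurd h hp⟩
      obtain ⟨η, hη, D, hD, hne⟩ := hcon (p ⟨⟩) (hp _)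
      obtain ⟨q, hq, hb⟩ := bdd_of_lt D (S := F '' Set.Iio δ)
        (by rintro _ ⟨ξ, -, rfl⟩; exact hFm ξ)
        (mk_image_le.trans_lt (lt_of_le_of_lt (by
          rw [mk_Iio_ordinal, Cardinal.lift_le]
          simpa using Ordinal.card_le_card hδ) hD))
      refine ⟨fun _ => q, η, fun _ => ⟨fun _ => hq, hη, fun ξ hξ hle => ?_⟩⟩
      rw [← Ultrafilter.compl_mem_iff_notMem] at hne
      obtain ⟨a, ⟨ha1, ha2⟩, ha3⟩ := D.nonempty_of_mem (Filter.inter_mem (Filter.inter_mem hne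
        (hFle ξ hξ η hle D hD)) (hb _ ⟨ξ, hξ, rfl⟩))
      have ha1' : p ⟨⟩ a < f η a := by simpa using ha1
      exact ⟨a, lt_of_lt_of_le ha1' ha2, le_of_lt ha3⟩
    choose step E hst using hstep
    obtain ⟨g, hg, hmono⟩ := iterate hA hτA step (fun p hp => (hst p hp).1)
    have hC' : ∃ ξ < δ, ∀ α < τ.ord, E (g α) ≤ ξ := by
      by_contra! hno
      refine hC ⟨(fun α => E (g α)) '' Set.Iio τ.ord, ?_, ?_, ?_⟩
      · rintro _ ⟨α, -, rfl⟩
        exact (hst _ (hg α)).2.1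
      · exact mk_image_le.trans (by rw [mk_Iio_ordinal, card_ord])
      · intro η hη
        obtain ⟨α, hα, h⟩ := hno η hη
        exact ⟨_, ⟨α, hα, rfl⟩, h.le⟩
    obtain ⟨ξ, hξ, hξE⟩ := hC'
    have key : ∀ α, ∃ a : ↥A, α < τ.ord →
        (g α ⟨⟩ a < F ξ a ∧ F ξ a ≤ step (g α) ⟨⟩ a) := by
      intro α
      by_cases hα : α < τ.ord
      · obtain ⟨a, ha⟩ := (hst _ (hg α)).2.2 ξ hξ (hξE α hα)
        exact ⟨a, fun _ => ha⟩
      · have h0 : 0 < τ.ord := by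
          rw [Cardinal.lt_ord, Ordinal.card_zero, ← Cardinal.lift_lt.{_, 1}, hτ, Cardinal.lift_zero]
          exact lt_of_le_of_lt zero_le (Order.lt_succ _)
        obtain ⟨a, ha⟩ := (hst _ (hg 0)).2.2 ξ hξ (hξE 0 h0)
        exact ⟨a, fun h => absurd h hα⟩
    choose y hy using key
    refine no_inj_s6 hτ y fun β hβ α hαβ heq => ?_
    have h1 := (hy α (hαβ.trans hβ)).2
    have h2 := (hy β hβ).1
    rw [heq] at h1
    exact (h1.trans (hmono β hβ α hαβ ⟨⟩ (y β))).not_gt h2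

/-- If `A` is progressive and every regular limit point of `pcf(A)`
belongs to `pcf(A)`, then `pcf(A) = spec(A)`. -/
theorem statement6 (A : Set Cardinal.{0}) (hA : ∀ a ∈ A, a.IsRegular)
    (hne : A.Nonempty) (hprog : #A < Cardinal.lift.{1} (sInf A))
    (hclosed : ∀ κ : Cardinal.{0}, κ.IsRegular → IsLimitPt (pcf A) κ → κ ∈ pcf A) :
    pcf A = spec A := by
  refine subset_antisymm (pcf_subset_spec hA) ?_
  rintro κ ⟨hreg, F, hF, hFc, hunb⟩
  by_contra hκ
  by_cases hmin : ∀ a ∈ A, κ ≤ a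
  · refine hunb F subset_rfl hFc ⟨supf A F, supf_mem hA F, fun f hf a => ?_⟩
    refine (lt_supf hA hF a ?_ hf).le
    rw [hFc, Cardinal.lift_lt]
    refine lt_of_le_of_ne (hmin a a.2) ?_
    rintro rfl
    exact hκ (mem_pcf_of_mem hA a.2)
  push Not at hmin
  obtain ⟨a₀, ha₀, hlt₀⟩ := hmin
  obtain ⟨ν, hν, hνA⟩ := Cardinal.lt_lift_iff.1 hprog
  have hτA : ∀ a ∈ A, Order.succ ν ≤ a := fun a ha =>
    Order.succ_le_of_lt (hν.trans_le (csInf_le' ha))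
  have hτ : Cardinal.lift.{1} (Order.succ ν) = Order.succ #A := by rw [Cardinal.lift_succ, hνA]
  have hτκ : Order.succ ν < κ := (hτA a₀ ha₀).trans_lt hlt₀
  have hκω : ℵ₀ < κ := (hA a₀ ha₀).aleph0_le.trans_lt hlt₀
  have hbdd : ∃ β < κ, ∀ x ∈ pcf A, x < κ → x ≤ β := by
    by_contra! hcon
    refine hκ (hclosed κ hreg fun β hβ => ?_)
    obtain ⟨x, hx, h1, h2⟩ := hcon β hβ
    exact ⟨x, hx, h2, h1⟩
  obtain ⟨β, hβ, hpcf⟩ := hbdd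
  -- a bound modulo the large ultrafilters
  have he : #(Set.Iio κ.ord) = #F := by rw [mk_Iio_ordinal, card_ord, hFc]
  obtain ⟨e⟩ := Cardinal.eq.1 he
  classical
  obtain ⟨h, hh, hbound⟩ := directed hA hτA hτ hτκ κ.ord le_rfl
    (fun ξ => if hξ : ξ < κ.ord then (e ⟨ξ, hξ⟩ : ↥A → Ordinal.{0}) else fun _ => 0)
    (fun ξ => by
      by_cases hξ : ξ < κ.ord
      · simpa only [dif_pos hξ] using hF (e ⟨ξ, hξ⟩).2
      · simpa only [dif_neg hξ] using zero_mem_pi hA)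
  have hbound' : ∀ f ∈ F, ∀ D : Ultrafilter ↥A, Cardinal.lift.{1} κ < cofUlt A D →
      {a | f a ≤ h a} ∈ D := by
    intro f hf D hD
    obtain ⟨⟨ξ, hξ⟩, heq⟩ := e.surjective ⟨f, hf⟩
    have h1 := hbound ξ hξ D hD
    rw [dif_pos (show ξ < κ.ord from hξ), heq] at h1
    exact h1
  -- the universal families
  have huniv := fun θ => universal hA hτA hτ θ
  choose U hU hUc hUcof using huniv
  let W : Set (↥A → Ordinal.{0}) := insert h (⋃ θ : Set.Iic β, U θ)
  have hWpi : W ⊆ piSet A := by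
    rintro f (rfl | hf)
    · exact hh
    · obtain ⟨θ, hθ⟩ := Set.mem_iUnion.1 hf
      exact hU _ hθ
  have hκω' : ℵ₀ < Cardinal.lift.{1} κ := by simpa using hκω
  have hIic : #(Set.Iic β) < Cardinal.lift.{1} κ := by
    have hinj : Function.Injective
        (fun x : Set.Iic β => (⟨x.1.ord, by
          have h1 : x.1 ≤ β := x.2
          exact Order.lt_add_one_iff.2 (Cardinal.ord_le_ord.2 h1)⟩ : Set.Iio (β.ord + 1))) := by
      intro x y hxy
      have : x.1.ord = y.1.ord := congrArg Subtype.val hxy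
      exact Subtype.ext (Cardinal.ord_injective this)
    refine (mk_le_of_injective hinj).trans_lt ?_
    rw [mk_Iio_ordinal, Cardinal.lift_lt, ← Cardinal.lt_ord]
    exact (Cardinal.isSuccLimit_ord hreg.aleph0_le).add_one_lt (Cardinal.ord_lt_ord.2 hβ)
  have hUn : #(⋃ θ : Set.Iic β, U θ) < Cardinal.lift.{1} κ := by
    refine (Cardinal.mk_iUnion_le _).trans_lt (Cardinal.mul_lt_of_lt hκω'.le hIic ?_)
    refine lt_of_le_of_lt (ciSup_le' (a := Cardinal.lift.{1} β) fun θ => ?_) (by simpa using hβ)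
    refine (hUc θ).trans ?_
    rw [Cardinal.lift_le]
    exact θ.2
  have hWc : #W < Cardinal.lift.{1} κ := by
    refine Cardinal.mk_insert_le.trans_lt ?_
    exact Cardinal.add_lt_of_lt hκω'.le hUn (Cardinal.one_lt_aleph0.trans hκω')
  have hFin : #(Finset W) < Cardinal.lift.{1} κ := by
    rcases finite_or_infinite W with hfin | hinf
    · exact (Cardinal.lt_aleph0_of_finite _).trans hκω'
    · rwa [Cardinal.mk_finset_of_infinite]
  have hcover : ∀ f : F, ∃ s : Finset W, ∀ a, ∃ v ∈ s, (f : ↥A → Ordinal.{0}) a ≤ v.1 a := by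
    rintro ⟨f, hf⟩
    by_contra! hcon
    have hne : Filter.NeBot (Filter.generate
        ((fun v : W => {a : ↥A | v.1 a < f a}) '' Set.univ)) := by
      rw [Filter.generate_neBot_iff]
      intro t ht htf
      obtain ⟨s, -, hsf, rfl⟩ := (Set.exists_subset_image_finite_and (p := fun x => x = t)).1
        ⟨t, ht, htf, rfl⟩
      obtain ⟨a, ha⟩ := hcon hsf.toFinset
      refine ⟨a, ?_⟩
      rintro _ ⟨v, hv, rfl⟩
      exact ha v (hsf.mem_toFinset.2 hv)
    let D := Ultrafilter.of (Filter.generate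
        ((fun v : W => {a : ↥A | v.1 a < f a}) '' Set.univ))
    have hD : ∀ v ∈ W, {a : ↥A | v a < f a} ∈ D := fun v hv =>
      Ultrafilter.of_le _ (Filter.mem_generate_of_mem ⟨⟨v, hv⟩, Set.mem_univ _, rfl⟩)
    have hD' : ∀ v ∈ W, {a : ↥A | f a ≤ v a} ∉ D := by
      intro v hv hcon
      obtain ⟨a, ha1, ha2⟩ := D.nonempty_of_mem (Filter.inter_mem (hD v hv) hcon)
      exact (show v a < f a from ha1).not_ge ha2
    rcases lt_trichotomy (cofUlt A D) (Cardinal.lift.{1} κ) with hlt | heq | hgt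
    · obtain ⟨θ, hθ, hθD⟩ := Cardinal.lt_lift_iff.1 hlt
      have hθβ : θ ≤ β := hpcf θ ⟨D, hθD⟩ hθ
      obtain ⟨u, hu, hu'⟩ := hUcof θ D hθD.symm f (hF hf)
      exact hD' u (Or.inr (Set.mem_iUnion.2 ⟨⟨θ, hθβ⟩, hu⟩)) hu'
    · exact hκ ⟨D, heq.symm⟩
    · exact hD' h (Or.inl rfl) (hbound' f hf D hgt)
  choose c hc using hcover
  obtain ⟨s, t, hts, htc, hcs⟩ := Cardinal.infinite_pigeonhole_set c (Cardinal.lift.{1} κ) hFc.ge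
    hκω'.le (by rw [hreg.lift.cof_ord]; exact hFin)
  let S : Set (↥A → Ordinal.{0}) := Subtype.val '' (s : Set W)
  have hS : S ⊆ piSet A := by
    rintro _ ⟨v, -, rfl⟩
    exact hWpi v.2
  refine hunb t hts (le_antisymm ((mk_le_mk_of_subset hts).trans hFc.le) htc)
    ⟨supf A S, supf_mem hA S, fun f hf a => ?_⟩
  obtain ⟨v, hv, hle⟩ := hc ⟨f, hts hf⟩ a
  rw [hcs hf] at hv
  refine hle.trans (lt_supf hA hS a ?_ ⟨v, hv, rfl⟩).le
  refine (mk_image_le.trans_lt (Cardinal.lt_aleph0_of_finite _)).trans_le ?_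
  simpa using (hA a a.2).aleph0_le

end TukeySpec
end

section
/- Let A be a set of infinite regular cardinals with order type less than μ := sup(A), such that every a ∈ A carries a Jónsson algebra. If μ⁺ ∈ spec*(A), then μ⁺ carries a Jónsson algebra. -/
universe u

open Cardinal Set

namespace TukeySpec

/-- Every countable family of operations on lists has a countable family of term operations
generating closed hulls. -/
theorem exists_terms {ι : Type} [Countable ι] (c : ι → List Ordinal.{0} → Ordinal.{0}) :
    ∃ d : ℕ → List Ordinal.{0} → Ordinal.{0}, ∀ S : Set Ordinal.{0}, ∃ T : Set Ordinal.{0},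
      S ⊆ T ∧ (∀ i l, (∀ x ∈ l, x ∈ T) → c i l ∈ T) ∧
      ∀ x ∈ T, ∃ n l, (∀ y ∈ l, y ∈ S) ∧ d n l = x := by
  classical
  let L : FirstOrder.Language.{0, 0} := ⟨fun _ => ι, fun _ => Empty⟩
  let inst : L.Structure Ordinal.{0} :=
    { funMap := fun {n} (i : ι) v => c i (List.ofFn v)
      RelMap := fun {n} (r : Empty) _ => r.elim }
  have : Countable (Σ l, L.Functions l) := by
    change Countable (Σ l : ℕ, ι)
    infer_instance
  have hne : Nonempty (L.Term ℕ) := ⟨FirstOrder.Language.Term.var 0⟩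
  obtain ⟨e, he⟩ := exists_surjective_nat (L.Term ℕ)
  refine ⟨fun n l => (e n).realize (fun i => l.getD i 0), fun S =>
    ⟨(FirstOrder.Language.Substructure.closure L S : Set Ordinal.{0}),
      FirstOrder.Language.Substructure.subset_closure, ?_, ?_⟩⟩
  · intro i l hl
    have := (FirstOrder.Language.Substructure.closure L S).fun_mem
      (n := l.length) (show L.Functions l.length from i) (fun j => l.get j)
      (fun j => hl _ (List.get_mem l j))
    have h2 : inst.funMap (show L.Functions l.length from i) (fun j => l.get j) = c i l := by
      change c i (List.ofFn fun j => l.get j) = _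
      rw [List.ofFn_get]
    rw [← h2]
    exact this
  · intro x hx
    rw [SetLike.mem_coe, FirstOrder.Language.Substructure.mem_closure_iff_exists_term] at hx
    obtain ⟨t, rfl⟩ := hx
    let w : List Ordinal.{0} := t.varFinset.toList.map (fun a : S => (a : Ordinal.{0}))
    obtain ⟨n, hn⟩ := he (t.restrictVar (fun a => w.idxOf ((a : S) : Ordinal.{0})))
    refine ⟨n, w, ?_, ?_⟩
    · intro y hy
      obtain ⟨a, -, rfl⟩ := List.mem_map.1 hy
      exact Subtype.coe_prop a
    · change (e n).realize _ = _
      rw [hn]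
      apply FirstOrder.Language.Term.realize_restrictVar
      intro a
      have hm : ((a : S) : Ordinal.{0}) ∈ w := by
        simp only [w, List.mem_map]
        exact ⟨a, by simp, rfl⟩
      have hlt := List.idxOf_lt_length_iff.2 hm
      rw [List.getD_eq_getElem _ _ hlt, List.getElem_idxOf]

/-- An unbounded subset of a regular cardinal has full size. -/
theorem mk_of_unbounded {a : Cardinal.{0}} (ha : a.IsRegular) (S : Set Ordinal.{0})
    (hS : S ⊆ Set.Iio a.ord) (hu : ∀ β < a.ord, ∃ x ∈ S, β < x) :
    #S = Cardinal.lift.{1} a := by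
  apply le_antisymm
  · have := Cardinal.mk_le_mk_of_subset hS
    rwa [Cardinal.mk_Iio_ordinal, Cardinal.card_ord] at this
  · by_contra hlt
    rw [not_le] at hlt
    have hb : sSup S < a.ord := by
      apply Ordinal.sSup_lt_of_lt_cof
      · rwa [← Ordinal.lift_cof, ha.cof_ord]
      · exact fun x hx => hS hx
    obtain ⟨x, hx, hlt'⟩ := hu _ hb
    have hbd : BddAbove S := ⟨a.ord, fun y hy => (hS hy).le⟩
    exact absurd (le_csSup hbd hx) (not_le.2 hlt')

theorem exists_above {lam : Cardinal.{0}} (H : Set Ordinal.{0})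
    (hc : #H = Cardinal.lift.{1} lam) (γ : Ordinal.{0}) (hγ : γ < lam.ord) 
    (hl : ℵ₀ ≤ lam) :
    (H \ Set.Iic γ).Infinite := by
  intro hfin
  have hlim : Order.succ γ < lam.ord := (Cardinal.isSuccLimit_ord hl).succ_lt hγ
  have h1 : #(Set.Iic γ) < Cardinal.lift.{1} lam := by
    rw [← Order.Iio_succ, Cardinal.mk_Iio_ordinal, Cardinal.lift_lt]
    exact Cardinal.lt_ord.1 hlim
  have h2 : #(H \ Set.Iic γ : Set Ordinal.{0}) < Cardinal.lift.{1} lam :=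
    lt_of_lt_of_le (Cardinal.lt_aleph0_iff_set_finite.2 hfin) (by simpa using hl)
  have h3 : #H ≤ #(H \ Set.Iic γ : Set Ordinal.{0}) + #(Set.Iic γ) := by
    refine (Cardinal.mk_le_mk_of_subset ?_).trans (Cardinal.mk_union_le _ _)
    intro x hx
    by_cases h : x ∈ Set.Iic γ
    · exact Or.inr h
    · exact Or.inl ⟨hx, h⟩
  have h4 := Cardinal.add_lt_of_lt (by simpa using hl) h2 h1
  exact absurd (h3.trans_lt h4) (by rw [hc]; exact lt_irrefl _)

/-- The position of an element in a finite set of ordinals. -/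
noncomputable def pos (s : Finset Ordinal.{0}) (x : Ordinal.{0}) : ℕ :=
  (s.filter (· < x)).card

/-- The element at a position. -/
noncomputable def atPos (s : Finset Ordinal.{0}) (i : ℕ) : Ordinal.{0} :=
  sInf {x | x ∈ s ∧ pos s x = i}

theorem atPos_pos (s : Finset Ordinal.{0}) (x : Ordinal.{0}) (hx : x ∈ s) :
    atPos s (pos s x) = x := by
  have h : {y | y ∈ s ∧ pos s y = pos s x} = {x} := by
    ext y
    simp only [Set.mem_ofPred_eq, Set.mem_singleton_iff]
    have key : ∀ u v, u ∈ s → u < v → pos s u < pos s v := by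
      intro u v hu huv
      apply Finset.card_lt_card
      rw [Finset.ssubset_iff_of_subset]
      · exact ⟨u, by simp [hu, huv], by simp⟩
      · intro z hz
        simp only [Finset.mem_filter] at hz ⊢
        exact ⟨hz.1, hz.2.trans huv⟩
    constructor
    · rintro ⟨hy, he⟩
      rcases lt_trichotomy y x with h | h | h
      · exact absurd (key _ _ hy h) (by omega)
      · exact h
      · exact absurd (key _ _ hx h) (by omega)
    · rintro rfl
      exact ⟨hx, rfl⟩
  rw [atPos, h, csInf_singleton]

/-- A countable family of operations without proper closed sets of full size yields a
Jónsson algebra. -/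
theorem carriesJonsson_of_ops {ι : Type} [Countable ι] {lam : Cardinal.{0}} (hl : ℵ₀ ≤ lam)
    (c : ι → List Ordinal.{0} → Ordinal.{0})
    (hc : ∀ M ⊆ Set.Iio lam.ord, #M = Cardinal.lift.{1} lam →
      (∀ i l, (∀ x ∈ l, x ∈ M) → c i l < lam.ord → c i l ∈ M) → Set.Iio lam.ord ⊆ M) :
    CarriesJonsson lam := by
  classical
  have hpos : (0 : Ordinal.{0}) < lam.ord :=
    (Cardinal.lt_ord).2 (by simpa using lt_of_lt_of_le Cardinal.aleph0_pos hl)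
  obtain ⟨d, hd⟩ := exists_terms (fun i l => if c i l < lam.ord then c i l else 0)
  obtain ⟨e, he⟩ := exists_surjective_nat (ℕ × List ℕ)
  let G : Finset Ordinal.{0} → Ordinal.{0} := fun s =>
    d (e s.card.unpair.1).1 ((e s.card.unpair.1).2.map (atPos s))
  refine ⟨fun s => if G s < lam.ord then G s else 0, ?_, ?_⟩
  · intro s _
    dsimp only
    split_ifs with h
    · exact h
    · exact hpos
  · intro H hH hHc γ hγ
    obtain ⟨T, hST, hTc, hTd⟩ := hd H
    have hsub : Set.Iio lam.ord ⊆ T ∩ Set.Iio lam.ord := by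
      apply hc _ Set.inter_subset_right
      · apply le_antisymm
        · have := Cardinal.mk_le_mk_of_subset
            (Set.inter_subset_right : T ∩ Set.Iio lam.ord ⊆ Set.Iio lam.ord)
          rwa [Cardinal.mk_Iio_ordinal, Cardinal.card_ord] at this
        · rw [← hHc]
          exact Cardinal.mk_le_mk_of_subset (Set.subset_inter hST hH)
      · intro i l hl' hlt
        refine ⟨?_, hlt⟩
        have := hTc i l (fun x hx => (hl' x hx).1)
        simpa [hlt] using this
    obtain ⟨n, l, hlH, hnl⟩ := hTd γ (hsub hγ).1
    let s0 := l.toFinset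
    obtain ⟨m, hm⟩ := he (n, l.map (pos s0))
    obtain ⟨b, hb, hbs⟩ : ∃ b < lam.ord, ∀ x ∈ s0, x ≤ b := by
      refine ⟨s0.sup id, ?_, fun x hx => Finset.le_sup (f := id) hx⟩
      rw [Finset.sup_lt_iff hpos]
      intro x hx
      exact hH (hlH x (by simpa [s0] using hx))
    obtain ⟨u, huH, huc⟩ := (exists_above H hHc b hb hl).exists_subset_card_eq
      (Nat.pair m s0.card - s0.card)
    have hdis : Disjoint s0 u := by
      rw [Finset.disjoint_left]
      intro x hx hxu
      exact (huH hxu).2 (hbs x hx)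
    have hcard : (s0 ∪ u).card = Nat.pair m s0.card := by
      rw [Finset.card_union_of_disjoint hdis, huc]
      have := Nat.right_le_pair m s0.card
      omega
    have hp : ∀ x ∈ s0, pos (s0 ∪ u) x = pos s0 x := by
      intro x hx
      unfold pos
      congr 1
      ext y
      simp only [Finset.mem_filter, Finset.mem_union]
      constructor
      · rintro ⟨h | h, hy⟩
        · exact ⟨h, hy⟩
        · exact absurd (hy.le.trans (hbs x hx)) (huH h).2
      · rintro ⟨h, hy⟩
        exact ⟨Or.inl h, hy⟩
    have hG : G (s0 ∪ u) = γ := by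
      simp only [G]
      rw [hcard, Nat.unpair_pair, hm, ← hnl]
      simp only [List.map_map]
      congr 1
      conv_rhs => rw [← List.map_id l]
      apply List.map_congr_left
      intro x hx
      have hx' : x ∈ s0 := by simpa [s0] using hx
      simp only [Function.comp, id]
      rw [← hp x hx']
      exact atPos_pos _ _ (Finset.mem_union_left _ hx')
    refine ⟨s0 ∪ u, ?_, ?_⟩
    · intro x hx
      rw [Finset.mem_coe, Finset.mem_union] at hx
      rcases hx with hx | hx
      · exact hlH x (by simpa [s0] using hx)
      · exact (huH hx).1
    · dsimp only
      rw [hG, if_pos hγ]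

/-- If `A` is a set of infinite regular cardinals of order type
less than `μ := sup A`, every `a ∈ A` carries a Jónsson algebra, and
`μ⁺ ∈ spec*(A)`, then `μ⁺` carries a Jónsson algebra. -/
theorem statement18 (A : Set Cardinal.{0}) (hA : ∀ a ∈ A, a.IsRegular)
    (hbdd : BddAbove A)
    (hot : ∃ o < (sSup A).ord, Nonempty (↥A ≃o ↥(Set.Iio o)))
    (hjon : ∀ a ∈ A, CarriesJonsson a)
    (hstar : specStarMem A (Order.succ (sSup A))) :
    CarriesJonsson (Order.succ (sSup A)) := by
  classical
  obtain ⟨o, ho, ⟨φ⟩⟩ := hot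
  obtain ⟨hreg, F, hFsub, hFc, hF⟩ := hstar
  set mu := sSup A with hmu
  set lam := Order.succ mu with hlam
  have hl : ℵ₀ ≤ lam := hreg.aleph0_le
  have hAne : A.Nonempty := by
    by_contra h
    rw [Set.not_nonempty_iff_eq_empty] at h
    have : mu = 0 := by rw [hmu, h]; simp
    rw [this] at ho
    simp at ho
  have hmu0 : ℵ₀ < mu := by
    by_contra hle
    rw [not_lt] at hle
    have hall : ∀ a ∈ A, a = ℵ₀ := fun a ha =>
      le_antisymm ((le_csSup hbdd ha).trans hle) (hA a ha).aleph0_le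
    obtain ⟨a1, ha1⟩ := hAne
    have hinj : Set.InjOn (fun g : ↥A → Ordinal.{0} => g ⟨a1, ha1⟩) F := by
      intro g _ g' _ hgg
      funext b
      have : b = ⟨a1, ha1⟩ := Subtype.ext ((hall b b.2).trans (hall a1 ha1).symm)
      rw [this]
      exact hgg
    have h1 : #F ≤ #(Set.Iio a1.ord) := by
      rw [← Cardinal.mk_image_eq_of_injOn _ _ hinj]
      apply Cardinal.mk_le_mk_of_subset
      rintro _ ⟨g, hg, rfl⟩
      exact hFsub hg ⟨a1, ha1⟩
    rw [hFc, Cardinal.mk_Iio_ordinal, Cardinal.card_ord, Cardinal.lift_le] at h1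
    exact absurd (h1.trans (le_csSup hbdd ha1)) (not_le.2 (Order.lt_succ mu))
  obtain ⟨a0, ha0, hlt0⟩ : ∃ a ∈ A, max o.card ℵ₀ < a :=
    exists_lt_of_lt_csSup hAne (max_lt (Cardinal.lt_ord.1 ho) hmu0)
  have hoa0 : o < a0.ord := Cardinal.lt_ord.2 ((le_max_left _ _).trans_lt hlt0)
  have hωa0 : ℵ₀ < a0 := (le_max_right _ _).trans_lt hlt0
  have hAlam : ∀ a ∈ A, a.ord < lam.ord := fun a ha =>
    Cardinal.ord_lt_ord.2 ((le_csSup hbdd ha).trans_lt (Order.lt_succ mu))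
  choose! J hJ1 hJ2 using hjon
  -- enumeration of the family
  have hcardF : #(Set.Iio lam.ord) = #F := by
    rw [hFc, Cardinal.mk_Iio_ordinal, Cardinal.card_ord]
  obtain ⟨E⟩ := Cardinal.eq.1 hcardF
  let f : Ordinal.{0} → ↥A → Ordinal.{0} := fun α =>
    if h : α < lam.ord then (E ⟨α, h⟩ : ↥A → Ordinal.{0}) else fun _ => 0
  have hfF : ∀ α < lam.ord, f α ∈ F := by
    intro α hα
    simp only [f, dif_pos hα]
    exact Subtype.coe_prop _
  have hfinj : Set.InjOn f (Set.Iio lam.ord) := by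
    intro α hα β hβ hab
    simp only [f, dif_pos (Set.mem_Iio.1 hα), dif_pos (Set.mem_Iio.1 hβ)] at hab
    have := E.injective (Subtype.ext hab)
    exact congrArg Subtype.val this
  -- enumeration of `A`
  let aa : Ordinal.{0} → ↥A := fun i => if h : i < o then φ.symm ⟨i, h⟩ else ⟨a0, ha0⟩
  have haa : ∀ a : ↥A, ∃ i < o, aa i = a := by
    intro a
    refine ⟨φ a, (φ a).2, ?_⟩
    simp only [aa]
    rw [dif_pos (show ((φ a : Set.Iio o) : Ordinal.{0}) < o from (φ a).2)]
    simp
  -- surjections from `mu`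
  have hex : ∀ α < lam.ord, ∃ e : Ordinal.{0} → Ordinal.{0}, ∀ β < α, ∃ ξ < mu.ord, e ξ = β := by
    intro α hα
    have hle : #(Set.Iio α) ≤ #(Set.Iio mu.ord) := by
      rw [Cardinal.mk_Iio_ordinal, Cardinal.mk_Iio_ordinal, Cardinal.card_ord, Cardinal.lift_le]
      exact Order.lt_succ_iff.1 (Cardinal.lt_ord.1 hα)
    obtain ⟨g⟩ := Cardinal.le_def _ _ |>.1 hle
    refine ⟨fun ξ => if h : ∃ β : Set.Iio α, (g β : Ordinal.{0}) = ξ then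
      (h.choose : Ordinal.{0}) else 0, fun β hβ => ⟨g ⟨β, hβ⟩, (g ⟨β, hβ⟩).2, ?_⟩⟩
    have h : ∃ β' : Set.Iio α, (g β' : Ordinal.{0}) = g ⟨β, hβ⟩ := ⟨⟨β, hβ⟩, rfl⟩
    dsimp only
    rw [dif_pos h]
    have := g.injective (Subtype.ext h.choose_spec)
    rw [this]
  choose! e he using hex
  let c0 : ℕ → List Ordinal.{0} → Ordinal.{0} := fun n l => match n, l with
    | 0, [i] => (aa i : Cardinal.{0}).ord
    | 1, [α, i] => f α (aa i)
    | 2, x :: l => J x.card l.toFinset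
    | 3, [α, ξ] => e α ξ
    | 4, l => J a0 l.toFinset
    | _, _ => 0
  -- a closed set which is unbounded in `a` contains `a`
  have absorb : ∀ (N : Set Ordinal.{0}) (a : Cardinal.{0}), a ∈ A →
      (∀ l : List Ordinal.{0}, (∀ x ∈ l, x ∈ N) → J a l.toFinset < lam.ord →
        J a l.toFinset ∈ N) →
      (∀ β < a.ord, ∃ x ∈ N, x < a.ord ∧ β < x) → Set.Iio a.ord ⊆ N := by
    intro N a ha hcl hub γ hγ
    have hsz : #(N ∩ Set.Iio a.ord : Set Ordinal.{0}) = Cardinal.lift.{1} a := by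
      apply mk_of_unbounded (hA a ha) _ Set.inter_subset_right
      intro β hβ
      obtain ⟨x, hx, hxa, hbx⟩ := hub β hβ
      exact ⟨x, ⟨hx, hxa⟩, hbx⟩
    obtain ⟨s, hs, hJs⟩ := hJ2 a ha _ Set.inter_subset_right hsz γ hγ
    have := hcl s.toList (fun x hx => (hs (by simpa using hx)).1)
    rw [Finset.toList_toFinset, hJs] at this
    exact this (lt_trans hγ (hAlam a ha))
  have core : ∀ N ⊆ Set.Iio lam.ord, #N = Cardinal.lift.{1} lam →
      (∀ i l, (∀ x ∈ l, x ∈ N) → c0 i l < lam.ord → c0 i l ∈ N) → Set.Iio o ⊆ N →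
      Set.Iio lam.ord ⊆ N := by
    intro N hN hNc hcl hoN
    have hfim : #(f '' N) = Cardinal.lift.{1} lam := by
      rw [Cardinal.mk_image_eq_of_injOn _ _ (hfinj.mono hN), hNc]
    have hfsub : f '' N ⊆ F := by
      rintro _ ⟨α, hα, rfl⟩
      exact hfF α (hN hα)
    have hmuN : Set.Iio mu.ord ⊆ N := by
      intro ξ hξ
      obtain ⟨a, haub, hξa⟩ := hF _ hfsub hfim ξ.card (Cardinal.lt_ord.1 hξ)
      obtain ⟨i, hio, rfl⟩ := haa a
      have hi : i ∈ N := hoN hio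
      have haN : (aa i : Cardinal.{0}).ord ∈ N :=
        hcl 0 [i] (by simpa using hi) (hAlam _ (aa i).2)
      refine absorb N (aa i) (aa i).2 ?_ ?_ (Cardinal.lt_ord.2 hξa)
      · intro l hlN hlt
        have := hcl 2 ((aa i : Cardinal.{0}).ord :: l) (by simpa using ⟨haN, hlN⟩)
        simp only [c0, Cardinal.card_ord] at this
        exact this hlt
      · intro β hβ
        obtain ⟨_, ⟨α, hα, rfl⟩, hlt⟩ := haub β hβ
        have hfa : f α (aa i) < (aa i : Cardinal.{0}).ord := hFsub (hfF α (hN hα)) (aa i)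
        exact ⟨f α (aa i), hcl 1 [α, i] (by simp [hα, hi])
          (lt_trans hfa (hAlam _ (aa i).2)), hfa, hlt⟩
    intro γ hγ
    obtain ⟨α, hα, hγα⟩ := (exists_above N hNc γ hγ hl).nonempty
    obtain ⟨ξ, hξ, hee⟩ := he α (hN hα) γ (not_le.1 hγα)
    rw [← hee]
    refine hcl 3 [α, ξ] (by simp [hα, hmuN hξ]) ?_
    change e α ξ < lam.ord
    rw [hee]
    exact hγ
  obtain ⟨d, hd⟩ := exists_terms (fun i l => if c0 i l < lam.ord then c0 i l else 0)
  -- bounds for the values of terms below `a0`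
  have hbound : ∀ (n : ℕ) (m : List Ordinal.{0}), ∃ b < a0.ord, ∀ l : List Ordinal.{0},
      (∀ x ∈ l, x ∈ m ∨ x < o) → d n l < a0.ord → d n l ≤ b := by
    intro n m
    by_contra hcon
    push Not at hcon
    let P : Set Ordinal.{0} := {x | x ∈ m} ∪ Set.Iio o
    let S : Set Ordinal.{0} := {x | x < a0.ord ∧ ∃ l : List P, d n (l.map Subtype.val) = x}
    have hS : #S = Cardinal.lift.{1} a0 := by
      apply mk_of_unbounded (hA a0 ha0) _ (fun x hx => hx.1)
      intro β hβ
      obtain ⟨l, hlm, hla, hlb⟩ := hcon β hβ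
      refine ⟨d n l, ⟨hla, l.attach.map (fun x => ⟨x.1, hlm x.1 x.2⟩), ?_⟩, hlb⟩
      rw [List.map_map]
      congr 1
      exact List.attach_map_subtype_val l
    have h1 : #S ≤ #(List P) := by
      refine (Cardinal.mk_le_mk_of_subset (t := Set.range
        (fun l : List P => d n (l.map Subtype.val))) ?_).trans Cardinal.mk_range_le
      rintro x ⟨-, l, rfl⟩
      exact ⟨l, rfl⟩
    have hω : ℵ₀ < Cardinal.lift.{1} a0 := by simpa using hωa0
    have h2 : #P < Cardinal.lift.{1} a0 := by
      refine (Cardinal.mk_union_le _ _).trans_lt (Cardinal.add_lt_of_lt hω.le ?_ ?_)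
      · exact (Cardinal.lt_aleph0_iff_set_finite.2 (List.finite_toSet m)).trans hω
      · rw [Cardinal.mk_Iio_ordinal, Cardinal.lift_lt]
        exact Cardinal.lt_ord.1 hoa0
    have h3 := (h1.trans (Cardinal.mk_list_le_max P)).trans_lt (max_lt hω h2)
    exact absurd h3 (by rw [hS]; exact lt_irrefl _)
  choose g hg1 hg2 using hbound
  refine carriesJonsson_of_ops hl (ι := ℕ ⊕ ℕ) (Sum.elim c0 g) ?_
  intro M hM hMc hcl
  have hcl0 : ∀ i l, (∀ x ∈ l, x ∈ M) → c0 i l < lam.ord → c0 i l ∈ M :=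
    fun i l => hcl (Sum.inl i) l
  apply core M hM hMc hcl0
  obtain ⟨T, hPT, hTc, hTd⟩ := hd (M ∪ Set.Iio o)
  have holam : o < lam.ord := hoa0.trans (hAlam a0 ha0)
  have hNfull : Set.Iio lam.ord ⊆ T ∩ Set.Iio lam.ord := by
    apply core _ Set.inter_subset_right
    · apply le_antisymm
      · have := Cardinal.mk_le_mk_of_subset
          (Set.inter_subset_right : T ∩ Set.Iio lam.ord ⊆ Set.Iio lam.ord)
        rwa [Cardinal.mk_Iio_ordinal, Cardinal.card_ord] at this
      · rw [← hMc]
        exact Cardinal.mk_le_mk_of_subset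
          (Set.subset_inter (Set.subset_union_left.trans hPT) hM)
    · intro i l hlT hlt
      refine ⟨?_, hlt⟩
      have := hTc i l (fun x hx => (hlT x hx).1)
      simpa only [if_pos hlt] using this
    · exact fun x hx => ⟨hPT (Or.inr hx), lt_trans hx holam⟩
  have ha0M : Set.Iio a0.ord ⊆ M := by
    apply absorb M a0 ha0 (fun l => hcl0 4 l)
    intro β hβ
    have hsucc : Order.succ β < a0.ord := (Cardinal.isSuccLimit_ord hωa0.le).succ_lt hβ
    obtain ⟨n, l, hlP, hnl⟩ := hTd (Order.succ β) (hNfull (lt_trans hsucc (hAlam a0 ha0))).1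
    let m := l.filter (fun x => decide (x ∈ M))
    have hle := hg2 n m l (by
      intro x hx
      rcases hlP x hx with h | h
      · exact Or.inl (by simp [m, hx, h])
      · exact Or.inr h) (by rw [hnl]; exact hsucc)
    rw [hnl] at hle
    refine ⟨g n m, ?_, hg1 n m, Order.succ_le_iff.1 hle⟩
    exact hcl (Sum.inr n) m (fun x hx => by
      have := List.mem_filter.1 hx
      simpa using this.2) ((hg1 n m).trans (hAlam a0 ha0))
  exact fun x hx => ha0M (lt_trans hx hoa0)

end TukeySpec
end
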